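/- arXiv:2307.15234 — 3 statements merged into one kernel-verified Lean document; each statement's English description precedes it below -/
import Mathlib

section
/- (1) Let E/F be an unramified quadratic extension of nonarchimedean local fields of characteristic zero and let δ ∈ GL_n(F) be the norm of some element of GL_n(E), i.e. δ = σ(γ₀)γ₀ for some γ₀ ∈ GL_n(E). Then there exists a Kottwitz element γ ∈ GL_n(E) with σ(γ)γ = δ. (2) Let F be a nonarchimedean local field of characteristic zero, E = F × F with σ(a,b) = (b,a). Then for every δ ∈ GL_n(F) and every integer k ≥ 0 there exists a k-Kottwitz element γ ∈ GL_n(F) × GL_n(F) with σ(γ)γ = (δ, δ). -/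
/-!
STATEMENT 10: Existence of Kottwitz elements above a given norm.
(1) In an unramified quadratic extension E/F of p-adic fields, every norm
δ ∈ GL_n(F) is the norm of a Kottwitz element.
(2) For a p-adic field F and E = F × F with σ the swap, every δ ∈ GL_n(F) is,
for every k ≥ 0, the "norm" (δ, δ) of a k-Kottwitz element of GL_n(F) × GL_n(F).
-/

open Matrix

/-- `g ∈ GL_n(O_E)`: all entries of `g` and of an inverse of `g` are integral. -/
def InGLnO (p : ℕ) [Fact p.Prime] {E : Type*} [Field E] [Algebra ℤ_[p] E]
    {n : ℕ} (g : Matrix (Fin n) (Fin n) E) : Prop :=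
  (∀ i j, g i j ∈ integralClosure ℤ_[p] E) ∧
  ∃ h : Matrix (Fin n) (Fin n) E, (∀ i j, h i j ∈ integralClosure ℤ_[p] E) ∧
    g * h = 1 ∧ h * g = 1

/-- `γ` is a Kottwitz element. -/
def IsKottwitz (p : ℕ) [Fact p.Prime] {F E : Type*} [Field F] [Field E] [Algebra F E]
    [Algebra ℤ_[p] E] (σ : E ≃ₐ[F] E) {n : ℕ} (γ : Matrix (Fin n) (Fin n) E) : Prop :=
  (∃ c : Fin n → E, (∀ k, c k ∈ integralClosure ℤ_[p] E) ∧
    γ = ∑ k : Fin n, c k • ((γ.map ⇑σ) * γ) ^ (k : ℕ)) ∨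
  ¬ ∃ g : Matrix (Fin n) (Fin n) E, IsUnit g ∧ InGLnO p (g⁻¹ * ((γ.map ⇑σ) * γ) * g)

/-- `(γ₁, γ₂)` is a `k`-Kottwitz element of `GL_n(F) × GL_n(F)` (the split case
`E = F × F`, where `σ(γ₁,γ₂)γ = (γ₂γ₁, γ₁γ₂)`), relative to a uniformizer `ϖ`. -/
def IskKottwitzSplit (q : ℕ) [Fact q.Prime] {F : Type*} [Field F] [Algebra ℤ_[q] F]
    {n : ℕ} (hn : 1 ≤ n) (ϖ : F) (k : ℕ) (γ₁ γ₂ : Matrix (Fin n) (Fin n) F) : Prop :=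
  ∃ c : Fin n → F,
    (∃ u : F, u ∈ integralClosure ℤ_[q] F ∧ c ⟨0, hn⟩ = 1 + ϖ ^ k * u) ∧
    (∀ i : Fin n, i ≠ ⟨0, hn⟩ → ∃ u : F, u ∈ integralClosure ℤ_[q] F ∧ c i = ϖ ^ k * u) ∧
    γ₁ = ∑ i : Fin n, c i • (γ₂ * γ₁) ^ (i : ℕ)


theorem normForm_field {K : Type*} [Field K] [Finite K] (t ν a : K) (hD : t ^ 2 - 4 * ν ≠ 0) :
    ∃ x y : K, x ^ 2 + t * x * y + ν * y ^ 2 = a := by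
  classical
  have := Fintype.ofFinite K
  by_cases h2 : ringChar K = 2
  · obtain ⟨r, hr⟩ := FiniteField.isSquare_of_char_two h2 a
    exact ⟨r, 0, by rw [hr]; ring⟩
  · have hodd : Fintype.card K % 2 = 1 := FiniteField.odd_card_of_char_ne_two h2
    have h20 : (2 : K) ≠ 0 := Ring.two_ne_zero h2
    obtain ⟨u, v, huv⟩ := FiniteField.exists_root_sum_quadratic
      (f := Polynomial.C 1 * Polynomial.X ^ 2 + Polynomial.C 0 * Polynomial.X + Polynomial.C (-a))
      (g := Polynomial.C (-(t ^ 2 - 4 * ν) / 4) * Polynomial.X ^ 2 + Polynomial.C 0 * Polynomial.X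
        + Polynomial.C 0)
      (Polynomial.degree_quadratic one_ne_zero)
      (Polynomial.degree_quadratic (by
        have h4 : (4 : K) ≠ 0 := by
          have : (4 : K) = 2 * 2 := by norm_num
          rw [this]; exact mul_ne_zero h20 h20
        exact div_ne_zero (neg_ne_zero.mpr hD) h4)) hodd
    have h4 : (4 : K) ≠ 0 := by
      have : (4 : K) = 2 * 2 := by norm_num
      rw [this]; exact mul_ne_zero h20 h20
    simp at huv
    refine ⟨u - t * v / 2, v, ?_⟩
    field_simp at huv ⊢
    linear_combination huv

theorem normForm_reduced {R : Type*} [CommRing R] [Finite R] [IsReduced R] (t ν a : R)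
    (hD : IsUnit (t ^ 2 - 4 * ν)) :
    ∃ x y : R, x ^ 2 + t * x * y + ν * y ^ 2 = a := by
  classical
  let e := IsArtinianRing.equivPi R
  have key : ∀ I : MaximalSpectrum R, ∃ x y : R ⧸ I.asIdeal,
      x ^ 2 + e t I * x * y + e ν I * y ^ 2 = e a I := by
    intro I
    have := I.isMaximal
    let := Ideal.Quotient.field I.asIdeal
    have h1 := (hD.map e).map (Pi.evalRingHom (fun I : MaximalSpectrum R => R ⧸ I.asIdeal) I)
    have h2 := h1.ne_zero
    have : Finite (R ⧸ I.asIdeal) := Finite.of_surjective _ (Ideal.Quotient.mk_surjective)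
    simp only [map_sub, map_mul, map_pow, map_ofNat, Pi.evalRingHom_apply] at h2
    exact normForm_field _ _ _ h2
  choose x y h using key
  refine ⟨e.symm x, e.symm y, e.injective ?_⟩
  simp only [map_add, map_mul, map_pow, AlgEquiv.apply_symm_apply]
  funext I
  exact h I

/-- Abstract lifting step. -/
theorem normForm_lift {A : Type*} [CommRing A] (t ν a : A) (hD : IsUnit (t ^ 2 - 4 * ν))
    (ha : IsUnit a) (I : Ideal A) (hI : I ≤ (⊥ : Ideal A).jacobson)
    (hens : ∀ j ∈ I, ∃ v : A, IsUnit v ∧ v ^ 2 - v = j)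
    (x y : A) (hxy : x ^ 2 + t * x * y + ν * y ^ 2 - a ∈ I) :
    ∃ x y : A, x ^ 2 + t * x * y + ν * y ^ 2 = a := by
  obtain ⟨D, hDD⟩ := hD
  have hDi : (t ^ 2 - 4 * ν) * (↑D⁻¹ : A) = 1 := by rw [← hDD]; simp
  generalize (↑D⁻¹ : A) = d at hDi
  have hN : IsUnit (x ^ 2 + t * x * y + ν * y ^ 2) := by
    have : IsUnit (x ^ 2 + t * x * y + ν * y ^ 2 - a + a) := by
      obtain ⟨α, hα⟩ := ha
      have h1 := Ideal.mem_jacobson_bot.mp (hI hxy) (↑α⁻¹ : A)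
      have h2 := h1.mul α.isUnit
      rw [add_mul, mul_assoc, Units.inv_mul, one_mul, mul_one, hα] at h2
      exact h2
    simpa using this
  obtain ⟨N, hNN⟩ := hN
  have hNi : (x ^ 2 + t * x * y + ν * y ^ 2) * (↑N⁻¹ : A) = 1 := by rw [← hNN]; simp
  generalize (↑N⁻¹ : A) = m at hNi
  -- i = (a - N)/N
  obtain ⟨i, hi⟩ : ∃ i, i = (a - (x ^ 2 + t * x * y + ν * y ^ 2)) * m := ⟨_, rfl⟩
  have hiI : i ∈ I := by
    rw [hi]; apply Ideal.mul_mem_right; rw [← neg_sub]; exact I.neg_mem hxy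
  obtain ⟨v, hv, hvj⟩ := hens (-(ν * d) * i) (I.mul_mem_left _ hiI)
  obtain ⟨V, hVV⟩ := hv
  have hVi : v * (↑V⁻¹ : A) = 1 := by rw [← hVV]; simp
  generalize (↑V⁻¹ : A) = w at hVi
  have hs : i * w - ν * d * (i * w) ^ 2 = i := by
    linear_combination (-i * w ^ 2) * hvj + (i * (v * w + 1) - i * w) * hVi
  generalize i * w = s at hs
  have hNa : (x ^ 2 + t * x * y + ν * y ^ 2) * (1 + i) = a := by
    rw [hi]; linear_combination (a - (x ^ 2 + t * x * y + ν * y ^ 2)) * hNi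
  -- multiply by 1 + s τ, τ = d (t θ - 2 ν)
  obtain ⟨X, hX⟩ : ∃ X, X = 1 - 2 * ν * d * s := ⟨_, rfl⟩
  obtain ⟨Y, hY⟩ : ∃ Y, Y = t * d * s := ⟨_, rfl⟩
  have hXY : X ^ 2 + t * X * Y + ν * Y ^ 2 = 1 + i := by
    rw [← hs, hX, hY]
    linear_combination (s - ν * d * s ^ 2) * hDi
  refine ⟨x * X - ν * y * Y, x * Y + y * X + t * y * Y, ?_⟩
  rw [← hNa, ← hXY]; ring

theorem normForm_finite {R : Type*} [CommRing R] [Finite R] (t ν a : R)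
    (hD : IsUnit (t ^ 2 - 4 * ν)) (ha : IsUnit a) :
    ∃ x y : R, x ^ 2 + t * x * y + ν * y ^ 2 = a := by
  let q := Ideal.Quotient.mk (nilradical R)
  have hq : Function.Surjective q := Ideal.Quotient.mk_surjective
  have : IsReduced (R ⧸ nilradical R) :=
    (Ideal.isRadical_iff_quotient_reduced _).mp (Ideal.radical_isRadical _)
  have : Finite (R ⧸ nilradical R) := Finite.of_surjective _ hq
  obtain ⟨x, y, h⟩ := normForm_reduced (q t) (q ν) (q a) (by
    have := hD.map q
    rwa [map_sub, map_mul, map_pow, map_ofNat] at this)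
  obtain ⟨x, rfl⟩ := hq x
  obtain ⟨y, rfl⟩ := hq y
  refine normForm_lift t ν a hD ha (nilradical R)
    Ideal.radical_le_jacobson ?_ x y ?_
  · intro j hj
    obtain ⟨r, ⟨hr, h0⟩, -⟩ := Polynomial.existsUnique_nilpotent_sub_and_aeval_eq_zero
      (P := (Polynomial.X ^ 2 - Polynomial.X - Polynomial.C j : Polynomial R)) (x := (1 : R))
      (by simpa using (mem_nilradical.mp hj)) (by simp)
    refine ⟨r, ?_, ?_⟩
    · have := hr.isUnit_one_sub
      simpa using this
    · simp at h0; linear_combination h0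
  · rw [← Ideal.Quotient.eq_zero_iff_mem]
    change q _ = 0
    simp [h]

theorem normForm_complete {A : Type*} [CommRing A] (I : Ideal A) [IsAdicComplete I A]
    [Finite (A ⧸ I)] (t ν a : A)
    (hD : IsUnit (t ^ 2 - 4 * ν)) (ha : IsUnit a) :
    ∃ x y : A, x ^ 2 + t * x * y + ν * y ^ 2 = a := by
  let q := Ideal.Quotient.mk I
  have hq : Function.Surjective q := Ideal.Quotient.mk_surjective
  obtain ⟨x, y, h⟩ := normForm_finite (q t) (q ν) (q a) (by
    have := hD.map q
    rwa [map_sub, map_mul, map_pow, map_ofNat] at this) (ha.map q)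
  obtain ⟨x, rfl⟩ := hq x
  obtain ⟨y, rfl⟩ := hq y
  refine normForm_lift t ν a hD ha I (IsAdicComplete.le_jacobson_bot I) ?_ x y ?_
  · intro j hj
    obtain ⟨r, h0, hr⟩ := HenselianRing.is_henselian (I := I)
      (Polynomial.X ^ 2 - Polynomial.X - Polynomial.C j : Polynomial A)
      (by monicity!) (1 : A)
      (by simpa using hj) (by simp)
    refine ⟨r, ?_, ?_⟩
    · have := Ideal.mem_jacobson_bot.mp (IsAdicComplete.le_jacobson_bot I hr) 1
      simpa using this
    · simp at h0; linear_combination h0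
  · rw [← Ideal.Quotient.eq_zero_iff_mem]
    change q _ = 0
    simp [h]

theorem adicComplete_of_free (p : ℕ) [Fact p.Prime] (A : Type*) [CommRing A] [Algebra ℤ_[p] A]
    [Module.Finite ℤ_[p] A] [Module.Free ℤ_[p] A] :
    IsAdicComplete (Ideal.span {(p : A)}) A ∧ Finite (A ⧸ Ideal.span {(p : A)}) := by
  let b := Module.Free.chooseBasis ℤ_[p] A
  have hmem : ∀ (n : ℕ) (x : A), x ∈ Ideal.span {(p : A)} ^ n ↔
      ∀ i, b.repr x i ∈ (Ideal.span {(p : ℤ_[p])}) ^ n := by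
    intro n x
    simp only [Ideal.span_singleton_pow, Ideal.mem_span_singleton]
    constructor
    · rintro ⟨y, rfl⟩ i
      have : (p : A) ^ n * y = ((p : ℤ_[p]) ^ n) • y := by
        rw [Algebra.smul_def]; simp
      rw [this]; simp
    · intro h
      choose c hc using h
      refine ⟨∑ i, c i • b i, ?_⟩
      conv_lhs => rw [← b.sum_repr x]
      rw [Finset.mul_sum]
      refine Finset.sum_congr rfl fun i _ => ?_
      rw [hc i, mul_smul, Algebra.smul_def ((p : ℤ_[p]) ^ n)]; simp
  have hc : IsAdicComplete (Ideal.span {(p : ℤ_[p])}) ℤ_[p] := by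
    rw [← PadicInt.maximalIdeal_eq_span_p]; infer_instance
  refine ⟨{ haus' := ?_, prec' := ?_ }, ?_⟩
  · intro x hx
    simp only [SModEq.zero, smul_eq_mul, Ideal.mul_top, hmem] at hx
    rw [← b.repr.map_eq_zero_iff]
    ext i
    refine hc.haus' _ fun n => ?_
    simp only [SModEq.zero, smul_eq_mul, Ideal.mul_top]
    exact hx n i
  · intro f hf
    simp only [SModEq.sub_mem, smul_eq_mul, Ideal.mul_top, hmem] at hf ⊢
    have : ∀ i, ∃ L : ℤ_[p], ∀ n, b.repr (f n) i ≡ L [SMOD (Ideal.span {(p : ℤ_[p])} ^ n •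
        (⊤ : Submodule ℤ_[p] ℤ_[p]))] := by
      intro i
      apply hc.prec'
      intro m n hmn
      simp only [SModEq.sub_mem, smul_eq_mul, Ideal.mul_top]
      have := hf hmn i
      simpa using this
    choose L hL using this
    simp only [SModEq.sub_mem, smul_eq_mul, Ideal.mul_top] at hL
    refine ⟨∑ i, L i • b i, fun n i => ?_⟩
    have := hL i n
    rw [map_sub, Finsupp.sub_apply, b.repr_sum_self]
    exact this
  · let φ : A → (Module.Free.ChooseBasisIndex ℤ_[p] A → ℤ_[p] ⧸ Ideal.span {(p : ℤ_[p])}) :=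
      fun x i => Ideal.Quotient.mk _ (b.repr x i)
    have : Finite (ℤ_[p] ⧸ Ideal.span {(p : ℤ_[p])}) := by
      rw [← PadicInt.maximalIdeal_eq_span_p]
      exact Finite.of_equiv _ (PadicInt.residueField (p := p)).symm.toEquiv
    have hφ : ∀ x y, φ x = φ y → x - y ∈ Ideal.span {(p : A)} := by
      intro x y h
      have := (hmem 1 (x - y)).mpr (fun i => by
        have := congrFun h i
        rw [Ideal.Quotient.eq] at this
        simpa using this)
      simpa using this
    refine Finite.of_injective (fun z : A ⧸ Ideal.span {(p : A)} => φ (Quotient.out z)) ?_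
    intro z w h
    have := hφ _ _ h
    rw [← Ideal.Quotient.eq] at this
    have h1 : ∀ z : A ⧸ Ideal.span {(p : A)}, Ideal.Quotient.mk _ (Quotient.out z) = z :=
      fun z => Quotient.out_eq z
    rwa [h1, h1] at this


theorem isLocal_OE (p : ℕ) [Fact p.Prime] (E : Type*) [Field E]
    [Algebra ℚ_[p] E] [FiniteDimensional ℚ_[p] E] [Algebra ℤ_[p] E] [IsScalarTower ℤ_[p] ℚ_[p] E] :
    IsLocalRing (integralClosure ℤ_[p] E) := by
  have hint : ∀ x : E, x ∈ integralClosure ℤ_[p] E ↔ spectralNorm ℚ_[p] E x ≤ 1 := by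
    intro x
    have hx : IsIntegral ℚ_[p] x := Algebra.IsIntegral.isIntegral x
    rw [spectralNorm, spectralValue_le_one_iff (minpoly.monic hx), mem_integralClosure_iff]
    constructor
    · intro h n
      rw [minpoly.isIntegrallyClosed_eq_field_fractions' ℚ_[p] h, Polynomial.coeff_map]
      exact PadicInt.norm_le_one _
    · intro h
      have hl : minpoly ℚ_[p] x ∈ Polynomial.lifts (algebraMap ℤ_[p] ℚ_[p]) := by
        rw [Polynomial.lifts_iff_coeff_lifts]
        intro n
        exact ⟨⟨_, h n⟩, rfl⟩
      obtain ⟨q, hq, -, hqm⟩ := Polynomial.lifts_and_natDegree_eq_and_monic hl (minpoly.monic hx)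
      refine ⟨q, hqm, ?_⟩
      have := minpoly.aeval ℚ_[p] x
      rw [← hq, Polynomial.aeval_map_algebraMap] at this
      exact this
  have hunit : ∀ x : integralClosure ℤ_[p] E, ¬ IsUnit x → spectralNorm ℚ_[p] E (x : E) < 1 := by
    intro x hx
    by_contra hlt
    have h1 := (hint x).mp x.2
    have h2 : spectralMulAlgNorm ℚ_[p] E (x : E) = 1 := le_antisymm h1 (not_lt.mp hlt)
    have hx0 : (x : E) ≠ 0 := by
      intro h0; rw [h0, map_zero] at h2; exact zero_ne_one h2
    have h3 : spectralMulAlgNorm ℚ_[p] E ((x : E)⁻¹) = 1 := by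
      have := map_mul (spectralMulAlgNorm ℚ_[p] E) (x : E) (x : E)⁻¹
      rw [mul_inv_cancel₀ hx0, map_one, h2, one_mul] at this
      exact this.symm
    have h4 : (x : E)⁻¹ ∈ integralClosure ℤ_[p] E := (hint _).mpr h3.le
    exact hx (IsUnit.of_mul_eq_one ⟨_, h4⟩ (Subtype.ext (mul_inv_cancel₀ hx0)))
  refine IsLocalRing.of_isUnit_or_isUnit_one_sub_self fun a => ?_
  by_contra h
  push Not at h
  have h1 := hunit _ h.1
  have h2 := hunit _ h.2
  have h3 := isNonarchimedean_spectralNorm (K := ℚ_[p]) (L := E) (a : E) (1 - (a : E))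
  have h4 : spectralNorm ℚ_[p] E ((a : E) + (1 - a)) = 1 := by
    rw [add_sub_cancel]; exact spectralNorm_one
  rw [h4] at h3
  have := max_lt h1 h2
  push_cast at this
  linarith

theorem OE_basic (p : ℕ) [Fact p.Prime] (E : Type*) [Field E]
    [Algebra ℚ_[p] E] [FiniteDimensional ℚ_[p] E] [Algebra ℤ_[p] E] [IsScalarTower ℤ_[p] ℚ_[p] E] :
    Module.Finite ℤ_[p] (integralClosure ℤ_[p] E) ∧ Module.Free ℤ_[p] (integralClosure ℤ_[p] E) ∧
    IsDedekindDomain (integralClosure ℤ_[p] E) := by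
  have : CharZero ℚ_[p] := inferInstance
  have : Module.IsTorsionFree ℤ_[p] E := Module.IsTorsionFree.trans_faithfulSMul ℤ_[p] ℚ_[p] E
  refine ⟨IsIntegralClosure.finite ℤ_[p] ℚ_[p] E _, IsIntegralClosure.module_free ℤ_[p] ℚ_[p] E _,
    integralClosure.isDedekindDomain ℤ_[p] ℚ_[p] E⟩

theorem span_uniformizer (p : ℕ) [Fact p.Prime] (E : Type*) [Field E]
    [Algebra ℚ_[p] E] [FiniteDimensional ℚ_[p] E] [Algebra ℤ_[p] E] [IsScalarTower ℤ_[p] ℚ_[p] E]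
    (π : integralClosure ℤ_[p] E) (hπ : Irreducible π) :
    (∀ x, ¬ IsUnit x → π ∣ x) ∧ (Ideal.span {π}).IsMaximal := by
  have := isLocal_OE p E
  obtain ⟨h1, h2, h3⟩ := OE_basic p E
  have : IsPrincipalIdealRing (integralClosure ℤ_[p] E) := inferInstance
  have hmax : (Ideal.span {π}).IsMaximal := PrincipalIdealRing.isMaximal_of_irreducible hπ
  refine ⟨fun x hx => ?_, hmax⟩
  rw [← Ideal.mem_span_singleton, IsLocalRing.eq_maximalIdeal hmax]
  exact hx

theorem int_descend (p : ℕ) [Fact p.Prime] {F E : Type*} [Field F] [Field E] [Algebra F E]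
    [Algebra ℤ_[p] F] [Algebra ℤ_[p] E] [IsScalarTower ℤ_[p] F E] (x : F)
    (hx : algebraMap F E x ∈ integralClosure ℤ_[p] E) : x ∈ integralClosure ℤ_[p] F :=
  (isIntegral_algebraMap_iff (algebraMap F E).injective).mp hx

theorem unit_descend (p : ℕ) [Fact p.Prime] {F E : Type*} [Field F] [Field E] [Algebra F E]
    [Algebra ℤ_[p] F] [Algebra ℤ_[p] E] [IsScalarTower ℤ_[p] F E] (x : integralClosure ℤ_[p] F)
    (z : E) (hz : z ∈ integralClosure ℤ_[p] E) (h : algebraMap F E x * z = 1) : IsUnit x := by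
  have hx0 : algebraMap F E x ≠ 0 := left_ne_zero_of_mul_eq_one h
  have hx : (x : F) ≠ 0 := fun h0 => hx0 (by rw [h0, map_zero])
  have hz' : z = algebraMap F E ((x : F)⁻¹) := by
    rw [map_inv₀]; exact eq_inv_of_mul_eq_one_right h
  rw [hz'] at hz
  exact IsUnit.of_mul_eq_one ⟨_, int_descend p _ hz⟩ (Subtype.ext (mul_inv_cancel₀ hx))

theorem exists_theta
    (p : ℕ) [Fact p.Prime] {F E : Type*} [Field F] [Field E]
    [Algebra ℚ_[p] E] [Algebra F E]
    [FiniteDimensional ℚ_[p] E]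
    [Algebra ℤ_[p] F] [Algebra ℤ_[p] E] [IsScalarTower ℤ_[p] F E]
    [IsScalarTower ℤ_[p] ℚ_[p] E]
    (σ : E ≃ₐ[F] E)
    (hσ2 : ∀ x : E, σ (σ x) = x)
    (hfix : ∀ x : E, σ x = x ↔ x ∈ Set.range (algebraMap F E))
    (hdeg : Module.finrank F E = 2)
    (π : F) (hπE : algebraMap F E π ∈ integralClosure ℤ_[p] E)
    (hirr : Irreducible (⟨algebraMap F E π, hπE⟩ : integralClosure ℤ_[p] E)) :
    ∃ (θ : E) (t ν : integralClosure ℤ_[p] F), θ ∈ integralClosure ℤ_[p] E ∧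
      θ + σ θ = algebraMap F E t ∧ θ * σ θ = algebraMap F E ν ∧ IsUnit (t ^ 2 - 4 * ν) := by
  have hσint : ∀ x ∈ integralClosure ℤ_[p] E, σ x ∈ integralClosure ℤ_[p] E := by
    intro x hx
    exact IsIntegral.map ((σ.restrictScalars ℤ_[p] : E ≃ₐ[ℤ_[p]] E) : E →ₐ[ℤ_[p]] E) hx
  have hfixint : ∀ x ∈ integralClosure ℤ_[p] E, σ x = x →
      ∃ a : integralClosure ℤ_[p] F, algebraMap F E a = x := by
    intro x hx hs
    obtain ⟨a, rfl⟩ := (hfix x).mp hs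
    exact ⟨⟨a, int_descend p a hx⟩, rfl⟩
  have hσπ : σ (algebraMap F E π) = algebraMap F E π := σ.commutes π
  set ϖ : integralClosure ℤ_[p] E := ⟨algebraMap F E π, hπE⟩ with hϖ
  obtain ⟨hdvd, hmax⟩ := span_uniformizer p E ϖ hirr
  obtain ⟨hfin, hfree, hded⟩ := OE_basic p E
  let s : integralClosure ℤ_[p] E → integralClosure ℤ_[p] E := fun x => ⟨σ x, hσint x x.2⟩
  -- it suffices to find θ with θ - σ θ a unit
  suffices H : ∃ θ : integralClosure ℤ_[p] E, IsUnit (θ - s θ) by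
    obtain ⟨θ, hθ⟩ := H
    obtain ⟨z, hz⟩ := hθ.exists_right_inv
    obtain ⟨t, ht⟩ := hfixint (θ + σ θ) (add_mem θ.2 (hσint _ θ.2)) (by
      rw [map_add, hσ2, add_comm])
    obtain ⟨ν, hν⟩ := hfixint (θ * σ θ) (mul_mem θ.2 (hσint _ θ.2)) (by
      rw [map_mul, hσ2, mul_comm])
    refine ⟨θ, t, ν, θ.2, ht.symm, hν.symm, ?_⟩
    refine unit_descend p (E := E) _ ((z : E) ^ 2) (pow_mem z.2 2) ?_
    have hz' : ((θ : E) - σ θ) * z = 1 := congrArg Subtype.val hz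
    change algebraMap F E ((t : F) ^ 2 - 4 * (ν : F)) * (z : E) ^ 2 = 1
    rw [map_sub, map_mul, map_pow, map_ofNat, ht, hν]
    linear_combination (((θ : E) - σ θ) * z + 1) * hz'
  by_contra hcon
  push Not at hcon
  have h1 : ∀ θ, ϖ ∣ θ - s θ := fun θ => hdvd _ (hcon θ)
  -- finiteness of residue field
  have hfink : Finite (integralClosure ℤ_[p] E ⧸ Ideal.span {ϖ}) := by
    obtain ⟨-, hf⟩ := adicComplete_of_free p (integralClosure ℤ_[p] E)
    have hle : Ideal.span {((p : ℕ) : integralClosure ℤ_[p] E)} ≤ Ideal.span {ϖ} := by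
      rw [Ideal.span_singleton_le_span_singleton]
      apply hdvd
      intro hu
      have h2 : IsUnit (algebraMap ℤ_[p] (integralClosure ℤ_[p] E) (p : ℤ_[p])) := by
        rw [map_natCast]; exact hu
      obtain ⟨z, hz⟩ := h2.exists_right_inv
      have hq : IsUnit (p : ℤ_[p]) := by
        have hzE : algebraMap ℚ_[p] E ((p : ℚ_[p])) * (z : E) = 1 := by
          have := congrArg Subtype.val hz
          simpa using this
        have : IsScalarTower ℤ_[p] ℚ_[p] E := inferInstance
        have hpp : (p : ℚ_[p]) ≠ 0 := by
          exact_mod_cast (Fact.out : p.Prime).ne_zero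
        have hz' : (z : E) = algebraMap ℚ_[p] E ((p : ℚ_[p])⁻¹) := by
          rw [map_inv₀]; exact eq_inv_of_mul_eq_one_right hzE
        have hi : IsIntegral ℤ_[p] ((p : ℚ_[p])⁻¹) := by
          have := z.2
          rw [hz'] at this
          exact (isIntegral_algebraMap_iff (algebraMap ℚ_[p] E).injective).mp this
        obtain ⟨w, hw⟩ := IsIntegrallyClosed.isIntegral_iff.mp hi
        refine IsUnit.of_mul_eq_one w ?_
        apply IsFractionRing.injective ℤ_[p] ℚ_[p]
        rw [map_mul, hw, map_natCast, map_one, mul_inv_cancel₀ hpp]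
      exact PadicInt.prime_p.not_isUnit hq
    exact Finite.of_surjective _ (Ideal.Quotient.factor_surjective hle)
  have h2 : ∀ θ : integralClosure ℤ_[p] E, ∃ (a : integralClosure ℤ_[p] F)
      (η : integralClosure ℤ_[p] E), (θ : E) = algebraMap F E a + algebraMap F E π * η := by
    intro θ
    by_cases h20 : IsUnit (2 : integralClosure ℤ_[p] E)
    · obtain ⟨z, hz⟩ := h20.exists_right_inv
      have hzE : (2 : E) * z = 1 := congrArg Subtype.val hz
      have hσz : σ z = z := by
        have h3 := congrArg σ hzE
        rw [map_mul, map_ofNat, map_one] at h3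
        linear_combination (z : E) * h3 - (σ z) * hzE
      obtain ⟨a, ha⟩ := hfixint (z * (θ + σ θ)) (mul_mem z.2 (add_mem θ.2 (hσint _ θ.2))) (by
        rw [map_mul, map_add, hσ2, hσz, add_comm])
      obtain ⟨η, hη⟩ := h1 θ
      have hη' : (θ : E) - σ θ = algebraMap F E π * η := congrArg Subtype.val hη
      refine ⟨a, z * η, ?_⟩
      push_cast
      rw [ha]
      linear_combination (-(θ : E)) * hzE + (z : E) * hη'
    · have := Ideal.Quotient.field (Ideal.span {ϖ})
      let := Ideal.Quotient.field (Ideal.span {ϖ})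
      have hch : ringChar (integralClosure ℤ_[p] E ⧸ Ideal.span {ϖ}) = 2 := by
        have h20' : (2 : integralClosure ℤ_[p] E ⧸ Ideal.span {ϖ}) = 0 := by
          have := Ideal.Quotient.eq_zero_iff_mem.mpr (Ideal.mem_span_singleton.mpr (hdvd _ h20))
          rwa [map_ofNat] at this
        by_contra hne
        exact Ring.two_ne_zero hne h20'
      obtain ⟨r, hr⟩ := FiniteField.isSquare_of_char_two hch
        (Ideal.Quotient.mk (Ideal.span {ϖ}) θ)
      obtain ⟨w, rfl⟩ := Ideal.Quotient.mk_surjective r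
      rw [← map_mul, Ideal.Quotient.eq, Ideal.mem_span_singleton] at hr
      obtain ⟨e, he⟩ := hr
      obtain ⟨a, ha⟩ := hfixint (w * σ w) (mul_mem w.2 (hσint _ w.2)) (by
        rw [map_mul, hσ2, mul_comm])
      obtain ⟨η, hη⟩ := h1 w
      have hη' : (w : E) - σ w = algebraMap F E π * η := congrArg Subtype.val hη
      have he' : (θ : E) - w * w = algebraMap F E π * e := congrArg Subtype.val he
      refine ⟨a, e + w * η, ?_⟩
      push_cast
      rw [ha]
      linear_combination he' + (w : E) * hη'
  have h3 : ∀ m : ℕ, ∀ θ, ϖ ^ m ∣ θ - s θ := by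
    intro m
    induction m with
    | zero => intro θ; simp
    | succ m ih =>
      intro θ
      obtain ⟨a, η, h⟩ := h2 θ
      have : θ - s θ = ϖ * (η - s η) := by
        apply Subtype.ext
        change (θ : E) - σ θ = algebraMap F E π * ((η : E) - σ η)
        have h4 := congrArg σ h
        rw [map_add, map_mul, σ.commutes, σ.commutes] at h4
        rw [h4, h]; ring
      rw [this, pow_succ']
      exact mul_dvd_mul_left _ (ih η)
  have h4 : ∀ θ, θ - s θ = 0 := by
    intro θ
    have hn : IsNoetherianRing (integralClosure ℤ_[p] E) := inferInstance
    have := Ideal.iInf_pow_eq_bot_of_isDomain (Ideal.span {ϖ}) hmax.ne_top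
    rw [← Ideal.mem_bot, ← this, Ideal.mem_iInf]
    intro m
    rw [Ideal.span_singleton_pow, Ideal.mem_span_singleton]
    exact h3 m θ
  have h5 : ∀ x : E, σ x = x := by
    intro x
    have : IsFractionRing (integralClosure ℤ_[p] E) E :=
      integralClosure.isFractionRing_of_finite_extension ℚ_[p] E
    obtain ⟨u, v, -, rfl⟩ := IsFractionRing.div_surjective (A := integralClosure ℤ_[p] E) x
    have h6 : ∀ u : integralClosure ℤ_[p] E, σ (algebraMap _ E u) = algebraMap _ E u := by
      intro u
      have := congrArg Subtype.val (h4 u)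
      change (u : E) - σ u = 0 at this
      exact (sub_eq_zero.mp this).symm
    rw [map_div₀, h6, h6]
  have h6 : (⊥ : Subalgebra F E) = ⊤ := by
    rw [eq_top_iff]
    intro x _
    exact Algebra.mem_bot.mpr ((hfix x).mp (h5 x))
  rw [Subalgebra.bot_eq_top_iff_finrank_eq_one] at h6
  omega

open Polynomial in
theorem exists_poly (p : ℕ) [Fact p.Prime] {F : Type*} [Field F]
    [Algebra ℚ_[p] F] [FiniteDimensional ℚ_[p] F] [Algebra ℤ_[p] F] [IsScalarTower ℤ_[p] ℚ_[p] F]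
    (f : (integralClosure ℤ_[p] F)[X]) (hf : f.Monic) (hdeg : f.natDegree ≠ 0)
    (hf0 : IsUnit (f.coeff 0))
    (t ν : integralClosure ℤ_[p] F) (hD : IsUnit (t ^ 2 - 4 * ν)) :
    ∃ P Q : (integralClosure ℤ_[p] F)[X], P.natDegree < f.natDegree ∧ Q.natDegree < f.natDegree ∧
      f ∣ P ^ 2 + C t * P * Q + C ν * Q ^ 2 - X := by
  obtain ⟨h1, h2, -⟩ := OE_basic p F
  have h3 : Module.Free (integralClosure ℤ_[p] F) (AdjoinRoot f) := hf.free_adjoinRoot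
  have h4 : Module.Finite (integralClosure ℤ_[p] F) (AdjoinRoot f) := hf.finite_adjoinRoot
  have h5 : Module.Free ℤ_[p] (AdjoinRoot f) :=
    Module.Free.trans (R := ℤ_[p]) (S := integralClosure ℤ_[p] F)
  have h6 : Module.Finite ℤ_[p] (AdjoinRoot f) :=
    Module.Finite.trans (integralClosure ℤ_[p] F) _
  obtain ⟨h7, h8⟩ := adicComplete_of_free p (AdjoinRoot f)
  have hX : IsUnit (AdjoinRoot.mk f X) := by
    have h9 := congrArg (AdjoinRoot.mk f) (X_mul_divX_add f)
    rw [AdjoinRoot.mk_self, map_add, map_mul] at h9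
    have h10 : IsUnit (AdjoinRoot.mk f (C (f.coeff 0))) := (hf0.map C).map _
    rw [eq_neg_of_add_eq_zero_right h9, IsUnit.neg_iff] at h10
    exact isUnit_of_mul_isUnit_left h10
  obtain ⟨x, y, hxy⟩ := normForm_complete (Ideal.span {((p : ℕ) : AdjoinRoot f)})
    (AdjoinRoot.mk f (C t)) (AdjoinRoot.mk f (C ν)) (AdjoinRoot.mk f X) (by
      have := (hD.map C).map (AdjoinRoot.mk f)
      simpa only [map_sub, map_mul, map_pow, map_ofNat] using this) hX
  obtain ⟨P, rfl⟩ := AdjoinRoot.mk_surjective x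
  obtain ⟨Q, rfl⟩ := AdjoinRoot.mk_surjective y
  have hf1 : f ≠ 1 := by rintro rfl; simp at hdeg
  have hmod : ∀ P, AdjoinRoot.mk f (P %ₘ f) = AdjoinRoot.mk f P := by
    intro P
    conv_rhs => rw [← modByMonic_add_div P f]
    simp
  refine ⟨P %ₘ f, Q %ₘ f, natDegree_modByMonic_lt _ hf hf1, natDegree_modByMonic_lt _ hf hf1, ?_⟩
  rw [← AdjoinRoot.mk_eq_zero]
  simp only [map_sub, map_add, map_mul, map_pow, hmod]
  rw [hxy, sub_self]

open Polynomial in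
theorem exists_gamma (p : ℕ) [Fact p.Prime] {F E : Type*} [Field F] [Field E]
    [Algebra ℚ_[p] F] [FiniteDimensional ℚ_[p] F] [Algebra F E]
    [Algebra ℤ_[p] F] [Algebra ℤ_[p] E] [IsScalarTower ℤ_[p] F E]
    [IsScalarTower ℤ_[p] ℚ_[p] F]
    (σ : E ≃ₐ[F] E) (θ : E) (t ν : integralClosure ℤ_[p] F) (hθ : θ ∈ integralClosure ℤ_[p] E)
    (ht : θ + σ θ = algebraMap F E t) (hν : θ * σ θ = algebraMap F E ν)
    (hD : IsUnit (t ^ 2 - 4 * ν)) (n : ℕ) (hn : 1 ≤ n)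
    (δ : Matrix (Fin n) (Fin n) F) (hδ : IsUnit δ)
    (f : (integralClosure ℤ_[p] F)[X]) (hf : f.Monic)
    (hfδ : f.map (algebraMap (integralClosure ℤ_[p] F) F) = δ.charpoly)
    (hf0 : IsUnit (f.coeff 0)) :
    ∃ γ : Matrix (Fin n) (Fin n) E, IsUnit γ ∧ IsKottwitz p σ γ ∧
        (γ.map ⇑σ) * γ = δ.map (algebraMap F E) := by
  have hdeg : f.natDegree = n := by
    have := hf.natDegree_map (algebraMap (integralClosure ℤ_[p] F) F)
    rw [← this, hfδ, Matrix.charpoly_natDegree_eq_dim, Fintype.card_fin]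
  obtain ⟨P, Q, hP, hQ, hdvd⟩ := exists_poly p f hf (by omega) hf0 t ν hD
  rw [hdeg] at hP hQ
  let ρ : integralClosure ℤ_[p] F →+* E := (algebraMap F E).comp (algebraMap _ F)
  have hρ : ∀ x, ρ x = algebraMap F E x := fun x => rfl
  have hρint : ∀ x, ρ x ∈ integralClosure ℤ_[p] E := fun x => x.2.algebraMap
  set M := δ.map (algebraMap F E) with hM
  have hMσ : M.map σ = M := by
    ext i j; simp [hM]
  have hMf : aeval M (f.map ρ) = 0 := by
    have : f.map ρ = M.charpoly := by
      rw [← Polynomial.map_map, hfδ, hM, ← Matrix.charpoly_map]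
    rw [this, Matrix.aeval_self_charpoly]
  let G : E[X] := P.map ρ + C θ * Q.map ρ
  have hσρ : (σ : E →+* E).comp ρ = ρ := by
    ext x; simp [hρ]
  have hGσ : G.map (σ : E →+* E) = P.map ρ + C (σ θ) * Q.map ρ := by
    simp only [G, Polynomial.map_add, Polynomial.map_mul, Polynomial.map_map, hσρ, map_C]
    rfl
  have hγσ : (aeval M G).map σ = aeval M (G.map (σ : E →+* E)) := by
    have := Polynomial.map_aeval_eq_aeval_map (φ := (σ : E →+* E))
      (ψ := (σ : E →+* E).mapMatrix (m := Fin n)) (by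
        ext r i j
        by_cases hij : i = j <;> simp [Matrix.algebraMap_matrix_apply, hij]) G M
    have h2 : (σ : E →+* E).mapMatrix M = M := hMσ
    rw [h2] at this
    exact this
  have hprod : (aeval M G).map σ * aeval M G = M := by
    rw [hγσ, hGσ, ← map_mul]
    obtain ⟨R, hR⟩ := hdvd
    have hR' := congrArg (Polynomial.map ρ) hR
    simp only [Polynomial.map_sub, Polynomial.map_add, Polynomial.map_mul, Polynomial.map_pow,
      map_C, map_X, hρ, ← ht, ← hν] at hR'
    have : (P.map ρ + C (σ θ) * Q.map ρ) * G = X + f.map ρ * R.map ρ := by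
      rw [← hR']
      simp only [G, map_add, map_mul]
      ring
    rw [this, map_add, map_mul, hMf, zero_mul, aeval_X, add_zero]
  have hMu : IsUnit M := hδ.map (algebraMap F E).mapMatrix
  refine ⟨aeval M G, ?_, Or.inl ⟨fun k => G.coeff k, ?_, ?_⟩, hprod⟩
  · rw [Matrix.isUnit_iff_isUnit_det] at hMu ⊢
    rw [← hprod, Matrix.det_mul] at hMu
    exact isUnit_of_mul_isUnit_right hMu
  · intro k
    simp only [G, coeff_add, coeff_C_mul, coeff_map]
    exact add_mem (hρint _) (mul_mem hθ (hρint _))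
  · rw [hprod]
    have hGd : G.natDegree < n := by
      refine lt_of_le_of_lt (natDegree_add_le _ _) (max_lt ?_ ?_)
      · exact lt_of_le_of_lt natDegree_map_le hP
      · exact lt_of_le_of_lt (natDegree_C_mul_le _ _) (lt_of_le_of_lt natDegree_map_le hQ)
    rw [aeval_eq_sum_range' hGd, Finset.sum_range]

theorem exists_kottwitz_with_given_norm
    (p : ℕ) [Fact p.Prime] {F E : Type*} [Field F] [Field E]
    [Algebra ℚ_[p] F] [Algebra ℚ_[p] E] [Algebra F E] [IsScalarTower ℚ_[p] F E]
    [FiniteDimensional ℚ_[p] F] [FiniteDimensional ℚ_[p] E]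
    [Algebra ℤ_[p] F] [Algebra ℤ_[p] E]
    [IsScalarTower ℤ_[p] ℚ_[p] F] [IsScalarTower ℤ_[p] ℚ_[p] E]
    (σ : E ≃ₐ[F] E)
    (hσ2 : ∀ x : E, σ (σ x) = x)
    (hfix : ∀ x : E, σ x = x ↔ x ∈ Set.range (algebraMap F E))
    (hdeg : Module.finrank F E = 2)
    -- unramifiedness: some uniformizer of O_F remains irreducible in O_E
    (hunr : ∃ (π : F) (hπ : π ∈ integralClosure ℤ_[p] F)
      (hπE : algebraMap F E π ∈ integralClosure ℤ_[p] E),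
      Irreducible (⟨π, hπ⟩ : integralClosure ℤ_[p] F) ∧
      Irreducible (⟨algebraMap F E π, hπE⟩ : integralClosure ℤ_[p] E))
    (n : ℕ) (hn : 1 ≤ n) :
    -- (1) inert case
    (∀ δ : Matrix (Fin n) (Fin n) F, IsUnit δ →
      (∃ γ₀ : Matrix (Fin n) (Fin n) E, IsUnit γ₀ ∧
        (γ₀.map ⇑σ) * γ₀ = δ.map (algebraMap F E)) →
      ∃ γ : Matrix (Fin n) (Fin n) E, IsUnit γ ∧ IsKottwitz p σ γ ∧
        (γ.map ⇑σ) * γ = δ.map (algebraMap F E)) ∧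
    -- (2) split case
    (∀ (q : ℕ) [Fact q.Prime] (F' : Type) [Field F'] [Algebra ℚ_[q] F']
      [FiniteDimensional ℚ_[q] F'] [Algebra ℤ_[q] F'] [IsScalarTower ℤ_[q] ℚ_[q] F']
      (ϖ : F') (hϖmem : ϖ ∈ integralClosure ℤ_[q] F')
      (hϖ : Irreducible (⟨ϖ, hϖmem⟩ : integralClosure ℤ_[q] F'))
      (δ : Matrix (Fin n) (Fin n) F'), IsUnit δ → ∀ k : ℕ,
      ∃ γ₁ γ₂ : Matrix (Fin n) (Fin n) F', IsUnit γ₁ ∧ IsUnit γ₂ ∧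
        γ₂ * γ₁ = δ ∧ γ₁ * γ₂ = δ ∧ IskKottwitzSplit q hn ϖ k γ₁ γ₂) := by
  have : IsScalarTower ℤ_[p] F E := by
    refine IsScalarTower.of_algebraMap_eq fun x => ?_
    rw [IsScalarTower.algebraMap_apply ℤ_[p] ℚ_[p] E, IsScalarTower.algebraMap_apply ℤ_[p] ℚ_[p] F,
      ← IsScalarTower.algebraMap_apply ℚ_[p] F E]
  refine ⟨?_, ?_⟩
  · rintro δ hδ ⟨γ₀, hγ₀, hnorm⟩
    by_cases hg : ∃ g : Matrix (Fin n) (Fin n) E, IsUnit g ∧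
        InGLnO p (g⁻¹ * δ.map (algebraMap F E) * g)
    swap
    · exact ⟨γ₀, hγ₀, Or.inr (by rw [hnorm]; exact hg), hnorm⟩
    obtain ⟨π, -, hπE, -, hirr⟩ := hunr
    obtain ⟨θ, t, ν, hθ, ht, hν, hD⟩ := exists_theta p σ hσ2 hfix hdeg π hπE hirr
    obtain ⟨g, hgu, hM, H, hH, hMH, -⟩ := hg
    set M := g⁻¹ * δ.map (algebraMap F E) * g with hMdef
    let M' : Matrix (Fin n) (Fin n) (integralClosure ℤ_[p] E) := fun i j => ⟨M i j, hM i j⟩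
    let H' : Matrix (Fin n) (Fin n) (integralClosure ℤ_[p] E) := fun i j => ⟨H i j, hH i j⟩
    let ι := algebraMap (integralClosure ℤ_[p] E) E
    have hM' : M'.map ι = M := rfl
    have hH' : H'.map ι = H := rfl
    have hMH' : M' * H' = 1 := by
      apply Matrix.map_injective (f := ι) Subtype.val_injective
      change (M' * H').map ι = (1 : Matrix (Fin n) (Fin n) _).map ι
      rw [Matrix.map_mul, hM', hH', hMH, Matrix.map_one _ (map_zero _) (map_one _)]
    have hchar : (δ.charpoly).map (algebraMap F E) = M'.charpoly.map ι := by
      rw [← Matrix.charpoly_map, ← Matrix.charpoly_map]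
      change (δ.map (algebraMap F E)).charpoly = M.charpoly
      have hdet : IsUnit g.det := (Matrix.isUnit_iff_isUnit_det g).mp hgu
      rw [hMdef, Matrix.charpoly_mul_comm, ← Matrix.mul_assoc, Matrix.mul_nonsing_inv g hdet,
        Matrix.one_mul]
    have hcoeff : ∀ k, algebraMap F E (δ.charpoly.coeff k) = (M'.charpoly.coeff k : E) := by
      intro k
      have := congrArg (fun q => Polynomial.coeff q k) hchar
      simp only [Polynomial.coeff_map] at this
      exact this
    have hlift : δ.charpoly ∈ Polynomial.lifts (algebraMap (integralClosure ℤ_[p] F) F) := by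
      rw [Polynomial.lifts_iff_coeff_lifts]
      intro k
      refine ⟨⟨δ.charpoly.coeff k, int_descend p (E := E) (δ.charpoly.coeff k) ?_⟩, rfl⟩
      rw [hcoeff]
      exact (M'.charpoly.coeff k).2
    obtain ⟨f, hfδ, -, hf⟩ :=
      Polynomial.lifts_and_natDegree_eq_and_monic hlift (Matrix.charpoly_monic δ)
    have hu : IsUnit (M'.charpoly.coeff 0) := by
      have h1 : IsUnit M'.det :=
        IsUnit.of_mul_eq_one H'.det (by rw [← Matrix.det_mul, hMH', Matrix.det_one])
      rw [Matrix.det_eq_sign_charpoly_coeff] at h1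
      exact isUnit_of_mul_isUnit_right h1
    obtain ⟨z, hz⟩ := hu.exists_right_inv
    refine exists_gamma p σ θ t ν hθ ht hν hD n hn δ hδ f hf hfδ ?_
    refine unit_descend p (E := E) _ z z.2 ?_
    have h2 : ((f.coeff 0 : integralClosure ℤ_[p] F) : F) = δ.charpoly.coeff 0 := by
      rw [← hfδ, Polynomial.coeff_map]; rfl
    rw [h2, hcoeff]
    exact congrArg Subtype.val hz
  · intro q _ F' _ _ _ _ _ ϖ hϖmem hϖ δ hδ k
    refine ⟨1, δ, isUnit_one, hδ, mul_one δ, one_mul δ,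
      fun i => if i = ⟨0, hn⟩ then 1 else 0, ⟨0, zero_mem _, by simp⟩, ?_, ?_⟩
    · intro i hi
      exact ⟨0, zero_mem _, by simp [hi]⟩
    · rw [Finset.sum_eq_single (⟨0, hn⟩ : Fin n)]
      · simp
      · intro i _ hi; simp [hi]
      · intro h; exact absurd (Finset.mem_univ _) h
end

section
/- For every ζ ∈ GL_n(O_E) there exists γ ∈ GL_n(E) such that ζ*ζ = σ(γ)γ. In other words, the β-twisted norm β⁻¹ζ*βζ of any ζ ∈ GL_n(O_E), for β a nonzero purely imaginary scalar matrix, lies in the image of the norm map γ ↦ σ(γ)γ on GL_n(E). -/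
/-!
STATEMENT 12: For every ζ ∈ GL_n(O_E) there exists γ ∈ GL_n(E) with ζ*ζ = σ(γ)γ;
that is, the twisted norm of any element of GL_n(O_E) is a norm from GL_n(E).
E/F is an unramified quadratic extension of nonarchimedean local fields of
characteristic zero (finite extensions of ℚ_p).
-/

open Matrix

theorem mem_span_p_pow_aux {R : Type*} [CommRing R] (q : R) (n : ℕ) (x : R) :
    x ∈ ((Ideal.span {q}) ^ n • (⊤ : Submodule R R)) ↔ ∃ y, x = q ^ n * y := by
  rw [Ideal.span_singleton_pow, Submodule.ideal_span_singleton_smul]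
  constructor
  · intro h
    obtain ⟨y, -, hy⟩ := (Submodule.mem_smul_pointwise_iff_exists _ _ _).1 h
    exact ⟨y, by rw [← hy, smul_eq_mul]⟩
  · rintro ⟨y, rfl⟩
    exact Submodule.smul_mem_pointwise_smul y _ ⊤ trivial

theorem isAdicComplete_p_aux (p : ℕ) [Fact p.Prime] (R : Type*) [CommRing R] [Algebra ℤ_[p] R]
    [Module.Finite ℤ_[p] R] [Module.Free ℤ_[p] R] :
    IsAdicComplete (Ideal.span {(p : R)}) R := by
  classical
  let b := Module.Free.chooseBasis ℤ_[p] R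
  have hsm : ∀ (n : ℕ) (y : R), (p : R) ^ n * y = ((p : ℤ_[p]) ^ n) • y := by
    intro n y
    rw [Algebra.smul_def]; simp
  have key : ∀ (n : ℕ) (x : R), (∃ y, x = (p : R) ^ n * y) ↔
      ∀ i, (p : ℤ_[p]) ^ n ∣ b.repr x i := by
    intro n x
    constructor
    · rintro ⟨y, rfl⟩ i
      rw [hsm]; simp
    · intro h
      choose c hc using h
      refine ⟨∑ i, c i • b i, ?_⟩
      rw [hsm, Finset.smul_sum]
      conv_lhs => rw [← b.sum_repr x]
      refine Finset.sum_congr rfl fun i _ => ?_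
      rw [hc i, mul_smul]
  have hZ : ∀ (n : ℕ) (x y : ℤ_[p]),
      (x ≡ y [SMOD ((IsLocalRing.maximalIdeal ℤ_[p]) ^ n • ⊤ : Submodule ℤ_[p] ℤ_[p])]) ↔
        (p : ℤ_[p]) ^ n ∣ x - y := by
    intro n x y
    rw [SModEq.sub_mem, PadicInt.maximalIdeal_eq_span_p, mem_span_p_pow_aux]
    rfl
  have hR : ∀ (n : ℕ) (x y : R),
      (x ≡ y [SMOD ((Ideal.span {(p : R)}) ^ n • ⊤ : Submodule R R)]) ↔
        ∀ i, (p : ℤ_[p]) ^ n ∣ b.repr x i - b.repr y i := by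
    intro n x y
    rw [SModEq.sub_mem, mem_span_p_pow_aux, key]
    simp
  have hH : IsHausdorff (Ideal.span {(p : R)}) R := by
    constructor
    intro x hx
    apply b.repr.injective
    ext i
    have := (inferInstance : IsHausdorff (IsLocalRing.maximalIdeal ℤ_[p]) ℤ_[p]).haus
      (b.repr x i) (fun n => by
        rw [hZ]; simpa using (hR n x 0).1 (hx n) i)
    simp [this]
  have hP : IsPrecomplete (Ideal.span {(p : R)}) R := by
    constructor
    intro f hf
    have : ∀ i, ∃ L : ℤ_[p], ∀ n, (p : ℤ_[p]) ^ n ∣ b.repr (f n) i - L := by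
      intro i
      obtain ⟨L, hL⟩ := (inferInstance : IsPrecomplete (IsLocalRing.maximalIdeal ℤ_[p]) ℤ_[p]).prec
        (f := fun n => b.repr (f n) i) (fun {m n} hmn => by
          rw [hZ]; exact (hR _ _ _).1 (hf hmn) i)
      exact ⟨L, fun n => (hZ _ _ _).1 (hL n)⟩
    choose L hL using this
    refine ⟨∑ i, L i • b i, fun n => ?_⟩
    rw [hR]
    intro i
    rw [b.repr_sum_self]
    exact hL i n
  exact { toIsHausdorff := hH, toIsPrecomplete := hP }

theorem finite_quot_p_aux (p : ℕ) [Fact p.Prime] (R : Type*) [CommRing R] [Algebra ℤ_[p] R]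
    [Module.Finite ℤ_[p] R] : Finite (R ⧸ Ideal.span {(p : R)}) := by
  obtain ⟨n, f, hf⟩ := Module.Finite.exists_fin' ℤ_[p] R
  have : Finite (ℤ_[p] ⧸ IsLocalRing.maximalIdeal ℤ_[p]) :=
    Finite.of_equiv (ZMod p) (PadicInt.residueField (p := p)).symm.toEquiv
  choose r hr using (Ideal.Quotient.mk_surjective (I := IsLocalRing.maximalIdeal ℤ_[p]))
  refine Finite.of_surjective (fun v : Fin n → (ℤ_[p] ⧸ IsLocalRing.maximalIdeal ℤ_[p]) =>
    Ideal.Quotient.mk (Ideal.span {(p : R)}) (f (fun i => r (v i)))) ?_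
  intro x
  obtain ⟨x, rfl⟩ := Ideal.Quotient.mk_surjective x
  obtain ⟨v, rfl⟩ := hf x
  refine ⟨fun i => Ideal.Quotient.mk _ (v i), ?_⟩
  have h1 : ∀ i, ∃ c, r (Ideal.Quotient.mk (IsLocalRing.maximalIdeal ℤ_[p]) (v i)) - v i
      = (p : ℤ_[p]) * c := by
    intro i
    have := Ideal.Quotient.eq.1 (hr (Ideal.Quotient.mk _ (v i)))
    exact Ideal.mem_span_singleton.1 (PadicInt.maximalIdeal_eq_span_p (p := p) ▸ this :
      _ ∈ Ideal.span {(p : ℤ_[p])})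
  choose c hc using h1
  rw [Ideal.Quotient.eq, ← map_sub, Ideal.mem_span_singleton]
  refine ⟨f c, ?_⟩
  have : ((fun i => r (Ideal.Quotient.mk (IsLocalRing.maximalIdeal ℤ_[p]) (v i))) - v)
      = (p : ℤ_[p]) • c := by
    ext1 i; exact hc i
  rw [this, map_smul, Algebra.smul_def]; simp

/-- lifting step -/
theorem norm_lift_aux {R : Type*} [CommRing R] (I : Ideal R) (t s D r r' a b : R)
    (hD : (t ^ 2 - 4 * s) * D = 1) (hr : r * r' = 1)
    (hab : a ^ 2 + t * a * b + s * b ^ 2 - r ∈ I)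
    (hI : I ≤ Ideal.jacobson ⊥)
    (hW : ∀ z ∈ I, ∃ W ∈ I, W ^ 2 + W = z) :
    ∃ a b : R, a ^ 2 + t * a * b + s * b ^ 2 = r := by
  obtain ⟨N, hN⟩ : ∃ N, N = a ^ 2 + t * a * b + s * b ^ 2 := ⟨_, rfl⟩
  rw [← hN] at hab
  have hu1 : ∀ z ∈ I, IsUnit (1 + z) := by
    intro z hz
    have := Ideal.mem_jacobson_bot.1 (hI hz) 1
    rwa [mul_one, add_comm] at this
  have hNu : IsUnit N := by
    have h1 := hu1 (r' * (N - r)) (I.mul_mem_left _ hab)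
    have : N = r * (1 + r' * (N - r)) := by linear_combination (-N + r) * hr
    rw [this]
    exact (IsUnit.of_mul_eq_one _ hr).mul h1
  obtain ⟨N', hN'⟩ := hNu.exists_right_inv
  -- trace one element u + vθ
  let u := -2 * s * D
  let v := t * D
  have huv : 2 * u + t * v = 1 := by simp only [u, v]; linear_combination hD
  clear_value u v
  let ν := u ^ 2 + t * u * v + s * v ^ 2
  let y := N' * (r - N)
  have hy : y ∈ I := I.mul_mem_left _ (by rw [← neg_sub]; exact I.neg_mem hab)
  obtain ⟨W, hWI, hWe⟩ := hW (ν * y) (I.mul_mem_left _ hy)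
  obtain ⟨w, hw⟩ := (hu1 W hWI).exists_right_inv
  let X := y * w
  have hνX : ν * X = W := by simp only [X]; linear_combination W * hw - w * hWe
  have hX : 1 + X + ν * X ^ 2 = 1 + y := by
    have h2 : X * (1 + W) = y := by simp only [X]; linear_combination y * hw
    linear_combination X * hνX + h2
  have hX' : (1 + u * X) ^ 2 + t * (1 + u * X) * (v * X) + s * (v * X) ^ 2 = 1 + y := by
    simp only [ν] at hX
    linear_combination hX + X * huv
  refine ⟨a * (1 + u * X) - s * b * (v * X), a * (v * X) + b * (1 + u * X) + t * b * (v * X), ?_⟩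
  have hNy : N * (1 + y) = r := by simp only [y]; linear_combination (r - N) * hN'
  rw [← hNy, ← hX', hN]
  ring

theorem norm_field_aux {k : Type*} [Field k] [Finite k] (t s r : k) (hD : t ^ 2 - 4 * s ≠ 0) :
    ∃ a b : k, a ^ 2 + t * a * b + s * b ^ 2 = r := by
  classical
  have := Fintype.ofFinite k
  by_cases h2 : ringChar k = 2
  · have : CharP k 2 := by rw [← h2]; exact ringChar.charP k
    obtain ⟨a, ha⟩ := FiniteField.isSquare_of_char_two h2 r
    exact ⟨a, 0, by rw [ha]; ring⟩
  · have h2' : (2 : k) ≠ 0 := Ring.two_ne_zero h2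
    have h4 : (4 : k) ≠ 0 := by
      have : (4 : k) = 2 * 2 := by norm_num
      rw [this]; exact mul_ne_zero h2' h2'
    obtain ⟨a, b, h⟩ := FiniteField.exists_root_sum_quadratic
      (f := Polynomial.C 1 * Polynomial.X ^ 2 + Polynomial.C 0 * Polynomial.X + Polynomial.C (-r))
      (g := Polynomial.C (-(t ^ 2 - 4 * s) / 4) * Polynomial.X ^ 2 + Polynomial.C 0 * Polynomial.X
        + Polynomial.C 0)
      (Polynomial.degree_quadratic one_ne_zero)
      (Polynomial.degree_quadratic (div_ne_zero (neg_ne_zero.2 hD) h4))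
      (FiniteField.odd_card_of_char_ne_two h2)
    refine ⟨a - t * b / 2, b, ?_⟩
    simp at h
    field_simp at h ⊢
    linear_combination h

theorem norm_finite_aux {R : Type*} [CommRing R] [Finite R] (t s D r r' : R)
    (hD : (t ^ 2 - 4 * s) * D = 1) (hr : r * r' = 1) :
    ∃ a b : R, a ^ 2 + t * a * b + s * b ^ 2 = r := by
  classical
  let Q := R ⧸ nilradical R
  have hfQ : Finite Q := Finite.of_surjective _ (Ideal.Quotient.mk_surjective (I := nilradical R))
  have : IsReduced Q := (Ideal.isRadical_iff_quotient_reduced _).1 (Ideal.radical_isRadical _)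
  let q : R →+* Q := Ideal.Quotient.mk (nilradical R)
  have hloc : ∀ m : MaximalSpectrum Q, ∃ ab : (Q ⧸ m.asIdeal) × (Q ⧸ m.asIdeal),
      ab.1 ^ 2 + (Ideal.Quotient.mk m.asIdeal (q t)) * ab.1 * ab.2
        + (Ideal.Quotient.mk m.asIdeal (q s)) * ab.2 ^ 2 = Ideal.Quotient.mk m.asIdeal (q r) := by
    intro m
    have := m.isMaximal
    let _ := Ideal.Quotient.field m.asIdeal
    have : Finite (Q ⧸ m.asIdeal) := Finite.of_surjective _ (Ideal.Quotient.mk_surjective)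
    obtain ⟨a, b, h⟩ := norm_field_aux (Ideal.Quotient.mk m.asIdeal (q t))
      (Ideal.Quotient.mk m.asIdeal (q s)) (Ideal.Quotient.mk m.asIdeal (q r)) (by
        have h1 := congrArg (fun x => Ideal.Quotient.mk m.asIdeal (q x)) hD
        simp only [map_mul, map_sub, map_pow, map_one] at h1
        have h4 : Ideal.Quotient.mk m.asIdeal (q 4) = 4 := by
          simp only [map_ofNat]
        rw [h4] at h1
        exact left_ne_zero_of_mul_eq_one h1)
    exact ⟨(a, b), h⟩
  choose ab hab using hloc
  let e := IsArtinianRing.equivPi Q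
  obtain ⟨a, ha⟩ := Ideal.Quotient.mk_surjective (e.symm (fun m => (ab m).1))
  obtain ⟨b, hb⟩ := Ideal.Quotient.mk_surjective (e.symm (fun m => (ab m).2))
  have hmem : a ^ 2 + t * a * b + s * b ^ 2 - r ∈ nilradical R := by
    rw [← Ideal.Quotient.eq_zero_iff_mem]
    change q _ = 0
    rw [map_sub, sub_eq_zero]
    apply e.injective
    funext m
    have ha' : e (q a) m = (ab m).1 := by
      change e (Ideal.Quotient.mk _ a) m = _
      rw [ha]; simp
    have hb' : e (q b) m = (ab m).2 := by
      change e (Ideal.Quotient.mk _ b) m = _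
      rw [hb]; simp
    have := hab m
    simp only [map_add, map_mul, map_pow, Pi.add_apply, Pi.mul_apply, Pi.pow_apply, ha', hb']
    exact this
  refine norm_lift_aux (nilradical R) t s D r r' a b hD hr hmem ?_ ?_
  · rw [Ideal.jacobson_bot]; exact nilradical_le_jacobson _
  · intro z hz
    obtain ⟨W, ⟨h1, h2⟩, -⟩ := Polynomial.existsUnique_nilpotent_sub_and_aeval_eq_zero
      (P := (Polynomial.X ^ 2 + Polynomial.X - Polynomial.C z : Polynomial R)) (x := (0 : R))
      (by simpa using mem_nilradical.1 hz) (by simp)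
    refine ⟨W, by simpa [mem_nilradical] using h1, ?_⟩
    simp at h2
    linear_combination h2

theorem henselian_quadratic_aux (p : ℕ) [Fact p.Prime] {R : Type*} [CommRing R] [Algebra ℤ_[p] R]
    [Module.Finite ℤ_[p] R] [Module.Free ℤ_[p] R] : HenselianRing R (Ideal.span {(p : R)}) := by
  have := isAdicComplete_p_aux p R
  infer_instance

theorem norm_padic_aux (p : ℕ) [Fact p.Prime] {R : Type*} [CommRing R] [Algebra ℤ_[p] R]
    [Module.Finite ℤ_[p] R] [Module.Free ℤ_[p] R] (t s D r r' : R)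
    (hD : (t ^ 2 - 4 * s) * D = 1) (hr : r * r' = 1) :
    ∃ a b : R, a ^ 2 + t * a * b + s * b ^ 2 = r := by
  have hH := henselian_quadratic_aux p (R := R)
  have := finite_quot_p_aux p R
  let q : R →+* (R ⧸ Ideal.span {(p : R)}) := Ideal.Quotient.mk _
  obtain ⟨a, b, h⟩ := norm_finite_aux (q t) (q s) (q D) (q r) (q r')
    (by rw [← map_ofNat q, ← map_pow, ← map_mul, ← map_sub, ← map_mul, hD, map_one])
    (by rw [← map_mul, hr, map_one])
  obtain ⟨a, rfl⟩ := Ideal.Quotient.mk_surjective a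
  obtain ⟨b, rfl⟩ := Ideal.Quotient.mk_surjective b
  refine norm_lift_aux (Ideal.span {(p : R)}) t s D r r' a b hD hr ?_ hH.jac ?_
  · rw [← Ideal.Quotient.eq]
    simpa using h
  · intro z hz
    rcases subsingleton_or_nontrivial R with hs | hnt
    · exact ⟨0, zero_mem _, Subsingleton.elim _ _⟩
    obtain ⟨W, h1, h2⟩ := hH.is_henselian (Polynomial.X ^ 2 + (Polynomial.X - Polynomial.C z))
      (Polynomial.monic_X_pow_add (by rw [Polynomial.degree_X_sub_C]; norm_num)) 0
      (by simpa using hz) (by simp)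
    refine ⟨W, by simpa using h2, ?_⟩
    simp at h1
    linear_combination h1

theorem pow_idem_aux {Q : Type*} [Monoid Q] [Finite Q] (x : Q) :
    ∃ m : ℕ, 0 < m ∧ x ^ m * x ^ m = x ^ m := by
  obtain ⟨i, j, hij, h⟩ := Finite.exists_ne_map_eq_of_infinite (fun n : ℕ => x ^ n)
  wlog hlt : i < j generalizing i j
  · exact this j i hij.symm h.symm (by omega)
  obtain ⟨d, rfl⟩ := Nat.exists_eq_add_of_lt hlt
  have step : ∀ l, x ^ (i + (d + 1) * l) = x ^ i := by
    intro l
    induction l with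
    | zero => simp
    | succ l ih =>
      have : i + (d + 1) * (l + 1) = (i + (d + 1) * l) + (d + 1) := by ring
      rw [this, pow_add, ih, ← pow_add]
      exact h.symm
  refine ⟨(d + 1) * (i + 1), by positivity, ?_⟩
  rw [← pow_add]
  have h1 : (d + 1) * (i + 1) + (d + 1) * (i + 1) =
      (i + (d + 1) * (i + 1)) + (d * i + d + 1) := by ring
  rw [h1, pow_add, step, ← pow_add]
  congr 1
  ring

theorem isLocalRing_aux (p : ℕ) [Fact p.Prime] (O : Type*) [CommRing O] [IsDomain O]
    [Algebra ℤ_[p] O] [Module.Finite ℤ_[p] O] [Module.Free ℤ_[p] O] : IsLocalRing O := by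
  have hH := henselian_quadratic_aux p (R := O)
  have := finite_quot_p_aux p O
  have hu1 : ∀ z ∈ Ideal.span {(p : O)}, IsUnit (1 + z) := by
    intro z hz
    have := Ideal.mem_jacobson_bot.1 (hH.jac hz) 1
    rwa [mul_one, add_comm] at this
  refine IsLocalRing.of_isUnit_or_isUnit_one_sub_self fun x => ?_
  obtain ⟨m, hm, hx⟩ := pow_idem_aux (Ideal.Quotient.mk (Ideal.span {(p : O)}) x)
  obtain ⟨e, he1, he2⟩ := hH.is_henselian (Polynomial.X ^ 2 + (- Polynomial.X))
      (Polynomial.monic_X_pow_add (by rw [Polynomial.degree_neg, Polynomial.degree_X]; norm_num))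
      (x ^ m)
      (by
        rw [← Ideal.Quotient.eq_zero_iff_mem]
        simp only [Polynomial.eval_add, Polynomial.eval_pow, Polynomial.eval_neg,
          Polynomial.eval_X, map_add, map_pow, map_neg]
        linear_combination hx)
      (by
        refine IsUnit.of_mul_eq_one
          ((Ideal.Quotient.mk (Ideal.span {(p : O)})) (2 * x ^ m - 1)) ?_
        simp only [Polynomial.derivative_add, Polynomial.derivative_neg, Polynomial.derivative_X,
          Polynomial.derivative_X_pow, Polynomial.eval_add, Polynomial.eval_neg,
          Polynomial.eval_mul, Polynomial.eval_one, Polynomial.eval_pow, Polynomial.eval_X,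
          Polynomial.eval_C, map_add, map_neg, map_sub, map_mul, map_pow, map_one, map_ofNat,
          Polynomial.eval_natCast, map_natCast]
        push_cast
        linear_combination 4 * hx)
  have he3 : e * (e - 1) = 0 := by
    simp [Polynomial.IsRoot] at he1
    linear_combination he1
  rcases mul_eq_zero.1 he3 with h0 | h1
  · right
    subst h0
    have h2 : IsUnit (1 - x ^ m) := by
      have := hu1 _ he2
      rwa [zero_sub, ← sub_eq_add_neg] at this
    refine isUnit_of_dvd_unit ?_ h2
    simpa using sub_dvd_pow_sub_pow 1 x m
  · left
    have h1 : e = 1 := by linear_combination h1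
    subst h1
    have h2 : IsUnit (x ^ m) := by
      have := hu1 _ (neg_mem he2)
      simpa using this
    exact (isUnit_pow_iff hm.ne').1 h2

theorem exists_theta_aux (p : ℕ) [Fact p.Prime] (O : Type*) [CommRing O] [IsDomain O]
    [Algebra ℤ_[p] O] [Module.Finite ℤ_[p] O] [Module.Free ℤ_[p] O] [IsDedekindDomain O]
    (σ : O →+* O) (hσ2 : ∀ x, σ (σ x) = x) (π : O) (hπ : Irreducible π) (hσπ : σ π = π)
    (hne : ∃ x, σ x ≠ x) : ∃ θ, IsUnit (θ - σ θ) := by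
  have hloc := isLocalRing_aux p O
  have hH := henselian_quadratic_aux p (R := O)
  have hpid : IsPrincipalIdealRing O := inferInstance
  have hmax : (Ideal.span {π}).IsMaximal := PrincipalIdealRing.isMaximal_of_irreducible hπ
  have hdvd : ∀ x : O, ¬ IsUnit x → π ∣ x := by
    intro x hx
    rw [← Ideal.mem_span_singleton, IsLocalRing.eq_maximalIdeal hmax]
    exact hx
  have hp : π ∣ (p : O) := by
    apply hdvd
    intro hu
    have h1 := Ideal.mem_jacobson_bot.1 (hH.jac (Ideal.mem_span_singleton_self (p : O)))
    obtain ⟨u, hu⟩ := hu.exists_right_inv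
    have := h1 (-u)
    rw [mul_neg, hu, neg_add_cancel] at this
    exact not_isUnit_zero this
  by_contra! hcon
  have hdiv : ∀ θ, π ∣ θ - σ θ := fun θ => hdvd _ (hcon θ)
  have claim : ∀ θ, ∃ a θ', σ a = a ∧ θ = a + π * θ' := by
    intro θ
    suffices h : ∃ a, σ a = a ∧ π ∣ θ - a by
      obtain ⟨a, ha, c, hc⟩ := h
      exact ⟨a, c, ha, by rw [← hc]; ring⟩
    rcases (Fact.out : p.Prime).eq_two_or_odd' with h2 | ⟨h, hodd⟩
    · subst h2
      have := finite_quot_p_aux 2 O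
      have hle : Ideal.span {((2 : ℕ) : O)} ≤ Ideal.span {π} :=
        Ideal.span_singleton_le_span_singleton.2 hp
      have : Finite (O ⧸ Ideal.span {π}) :=
        Finite.of_surjective _ (Ideal.Quotient.factor_surjective hle)
      let _ := Ideal.Quotient.field (Ideal.span {π})
      have := Fintype.ofFinite (O ⧸ Ideal.span {π})
      have h20 : ((2 : ℕ) : O ⧸ Ideal.span {π}) = 0 := by
        rw [← map_natCast (Ideal.Quotient.mk (Ideal.span {π})), Ideal.Quotient.eq_zero_iff_mem,
          Ideal.mem_span_singleton]
        exact hp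
      have hchar : ringChar (O ⧸ Ideal.span {π}) = 2 :=
        ((Nat.dvd_prime Nat.prime_two).1 (ringChar.dvd h20)).resolve_left
          (CharP.ringChar_ne_one)
      have hcard := FiniteField.even_card_iff_char_two.1 hchar
      obtain ⟨m, hm⟩ := Nat.dvd_of_mod_eq_zero hcard
      refine ⟨(θ * σ θ) ^ m, by rw [map_pow, map_mul, hσ2, mul_comm], ?_⟩
      rw [← Ideal.mem_span_singleton, ← Ideal.Quotient.eq]
      have h3 : Ideal.Quotient.mk (Ideal.span {π}) θ = Ideal.Quotient.mk (Ideal.span {π}) (σ θ) := by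
        rw [Ideal.Quotient.eq, Ideal.mem_span_singleton]; exact hdiv θ
      rw [map_pow, map_mul, ← h3, ← pow_two, ← pow_mul, ← hm]
      exact (FiniteField.pow_card _).symm
    · refine ⟨(h + 1 : ℕ) * (θ + σ θ), by rw [map_mul, map_natCast, map_add, hσ2, add_comm (σ θ)], ?_⟩
      have : θ - (h + 1 : ℕ) * (θ + σ θ) = (h + 1 : ℕ) * (θ - σ θ) - p * θ := by
        rw [hodd]; push_cast; ring
      rw [this]
      exact dvd_sub ((hdiv θ).mul_left _) (hp.mul_right _)
  have hk : ∀ (k : ℕ) (θ : O), π ^ k ∣ θ - σ θ := by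
    intro k
    induction k with
    | zero => simp
    | succ k ih =>
      intro θ
      obtain ⟨a, θ', ha, rfl⟩ := claim θ
      have : a + π * θ' - σ (a + π * θ') = π * (θ' - σ θ') := by
        rw [map_add, map_mul, ha, hσπ]; ring
      rw [this, pow_succ']
      exact mul_dvd_mul_left π (ih θ')
  obtain ⟨x, hx⟩ := hne
  have hfm : FiniteMultiplicity π (x - σ x) :=
    FiniteMultiplicity.of_not_isUnit hπ.not_isUnit (sub_ne_zero.2 (Ne.symm hx))
  obtain ⟨k, hk'⟩ := hfm
  exact hk' (hk _ x)

theorem exists_form_aux {F E : Type*} [Field F] [Field E] [CharZero E] [Algebra F E]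
    (σ : E ≃ₐ[F] E) (hσ2 : ∀ x : E, σ (σ x) = x)
    (hfix : ∀ x : E, σ x = x ↔ x ∈ Set.range (algebraMap F E))
    (hdeg : Module.finrank F E = 2) (ι : E) (hι : σ ι = -ι) (hι0 : ι ≠ 0) (d : ℕ) :
    ∀ (V : Type*) [AddCommGroup V] [Module E V] [Module F V] [IsScalarTower F E V]
      [FiniteDimensional E V] (_ : Module.finrank E V = d)
      (B : V → V → E) (_ : ∀ x y z, B x (y + z) = B x y + B x z)
      (_ : ∀ (a : E) x y, B x (a • y) = a * B x y)
      (_ : ∀ x y, σ (B x y) = B y x)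
      (_ : ∀ x, (∀ y, B y x = 0) → x = 0)
      (H : Module.End E V) (_ : ∀ x y, B (H x) y = B x (H y)),
      ∃ W : Submodule F V, (∀ w ∈ W, H w ∈ W) ∧
        (∀ x, ∃ w₁ ∈ W, ∃ w₂ ∈ W, x = w₁ + ι • w₂) ∧
        (∀ w₁ ∈ W, ∀ w₂ ∈ W, w₁ + ι • w₂ = 0 → w₁ = 0 ∧ w₂ = 0) := by
  induction d using Nat.strong_induction_on with
  | _ d ih =>
  intro V _ _ _ _ _ hd B hadd hsmul hherm hnd H hH
  have : FiniteDimensional F E := FiniteDimensional.of_finrank_pos (by rw [hdeg]; norm_num)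
  have : FiniteDimensional F V := Module.Finite.trans E V
  rcases subsingleton_or_nontrivial V with hsub | hnt
  · exact ⟨⊤, fun _ _ => trivial, fun x => ⟨0, trivial, 0, trivial, Subsingleton.elim _ _⟩,
      fun _ _ _ _ _ => ⟨Subsingleton.elim _ _, Subsingleton.elim _ _⟩⟩
  -- basic properties of B
  have hadd' : ∀ x y z, B (x + y) z = B x z + B y z := by
    intro x y z
    rw [← hherm z (x + y), hadd, map_add, hherm, hherm]
  have hsmul' : ∀ (a : E) x y, B (a • x) y = σ a * B x y := by
    intro a x y
    rw [← hherm y (a • x), hsmul, map_mul, hherm]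
  have hfsm : ∀ (a : F) (x : V), a • x = (algebraMap F E a) • x := by
    intro a x; rw [algebraMap_smul]
  have hFr : ∀ (a : F) x y, B x (a • y) = algebraMap F E a * B x y := by
    intro a x y; rw [hfsm, hsmul]
  have hFl : ∀ (a : F) x y, B (a • x) y = algebraMap F E a * B x y := by
    intro a x y; rw [hfsm, hsmul', AlgEquiv.commutes]
  have h0r : ∀ x, B x 0 = 0 := fun x => by
    have := hsmul 0 x 0; rwa [zero_smul, zero_mul] at this
  have h0l : ∀ x, B 0 x = 0 := fun x => by
    have := hsmul' 0 0 x; rwa [zero_smul, map_zero, zero_mul] at this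
  have sep : ∀ a b : E, σ a = a → σ b = b → a + ι * b = 0 → a = 0 ∧ b = 0 := by
    intro a b ha hb h
    have h1 := congrArg σ h
    rw [map_add, map_mul, ha, hb, hι, map_zero] at h1
    have ha0 : a = 0 := by
      have : (2 : E) * a = 0 := by linear_combination h + h1
      exact (mul_eq_zero.1 this).resolve_left two_ne_zero
    refine ⟨ha0, ?_⟩
    rw [ha0, zero_add] at h
    exact (mul_eq_zero.1 h).resolve_left hι0
  -- polynomials in H are self-adjoint
  have hself : ∀ (g : Polynomial F) x y,
      B (Polynomial.aeval H g x) y = B x (Polynomial.aeval H g y) := by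
    intro g
    induction g using Polynomial.induction_on' with
    | add g h hg hh =>
      intro x y
      rw [map_add, LinearMap.add_apply, LinearMap.add_apply, hadd, hadd', hg, hh]
    | monomial n a =>
      induction n with
      | zero =>
        intro x y
        simp only [Polynomial.monomial_zero_left, Polynomial.aeval_C]
        rw [Module.algebraMap_end_apply, Module.algebraMap_end_apply, hFr, hFl]
      | succ n ihn =>
        intro x y
        have hm : (Polynomial.monomial (n + 1) a : Polynomial F) =
          Polynomial.monomial n a * Polynomial.X := by
            rw [Polynomial.monomial_mul_X]
        have hm' : (Polynomial.monomial (n + 1) a : Polynomial F) =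
          Polynomial.X * Polynomial.monomial n a := by
            rw [Polynomial.X_mul_monomial]
        conv_lhs => rw [hm]
        conv_rhs => rw [hm']
        rw [map_mul, map_mul, Polynomial.aeval_X, Module.End.mul_apply, Module.End.mul_apply,
          ihn, hH]
  -- the minimal polynomial
  have hfinEnd : FiniteDimensional F (Module.End E V) := Module.Finite.trans E _
  have hHintegral : IsIntegral F H := IsIntegral.of_finite F H
  obtain ⟨φ, hφ, hφd⟩ := WfDvdMonoid.exists_irreducible_factor
    (minpoly.not_isUnit F H) (minpoly.ne_zero hHintegral)
  have hfm : FiniteMultiplicity φ (minpoly F H) :=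
    FiniteMultiplicity.of_not_isUnit hφ.not_isUnit (minpoly.ne_zero hHintegral)
  obtain ⟨ν, hν, hνd⟩ := hfm.exists_eq_pow_mul_and_not_dvd
  obtain ⟨e, he⟩ : ∃ e, multiplicity φ (minpoly F H) = e + 1 := by
    have h1 : multiplicity φ (minpoly F H) ≠ 0 := by
      intro h0
      rw [h0, pow_zero, one_mul] at hν
      rw [hν] at hφd
      exact hνd hφd
    exact ⟨_, (Nat.succ_pred_eq_of_ne_zero h1).symm⟩
  rw [he] at hν
  have hφp : Prime φ := hφ.prime
  have hQ : Polynomial.aeval H (φ ^ e * ν * ν) ≠ 0 := by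
    intro h0
    have h1 := minpoly.dvd F H h0
    have hne : φ ^ e * ν ≠ 0 := by
      intro h2
      apply minpoly.ne_zero hHintegral
      rw [hν, pow_succ', mul_assoc, h2, mul_zero]
    rw [hν, show φ ^ (e + 1) * ν = φ ^ e * ν * φ by ring] at h1
    exact hνd ((mul_dvd_mul_iff_left hne).1 h1)
  obtain ⟨w, hw⟩ : ∃ w, B (Polynomial.aeval H (φ ^ e * ν * ν) w) w ≠ 0 := by
    by_contra! hcon
    apply hQ
    set Q := Polynomial.aeval H (φ ^ e * ν * ν) with hQdef
    have hpol : ∀ x y, B (Q x) y + B (Q y) x = 0 := by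
      intro x y
      have := hcon (x + y)
      rw [map_add, hadd, hadd', hadd', hcon, hcon] at this
      linear_combination this
    ext x
    apply hnd
    intro y
    have h1 := hpol x y
    have h2 := hpol x (ι • y)
    rw [hsmul, map_smul, hsmul', hι] at h2
    have h3 : B (Q y) x = 0 := by
      have : (2 * ι) * B (Q y) x = 0 := by linear_combination ι * h1 - h2
      exact (mul_eq_zero.1 this).resolve_left (mul_ne_zero two_ne_zero hι0)
    rw [← hself, h3]
  obtain ⟨v, hv⟩ : ∃ v, v = Polynomial.aeval H ν w := ⟨_, rfl⟩
  have hv1 : B (Polynomial.aeval H (φ ^ e) v) v ≠ 0 := by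
    rw [hv, ← hself, ← Module.End.mul_apply, ← Module.End.mul_apply, ← map_mul, ← map_mul]
    rw [show ν * φ ^ e * ν = φ ^ e * ν * ν by ring]
    exact hw
  have hv2 : Polynomial.aeval H (φ ^ (e + 1)) v = 0 := by
    rw [hv, ← Module.End.mul_apply, ← map_mul, ← hν, minpoly.aeval, LinearMap.zero_apply]
  have hgv : ∀ g : Polynomial F, (∀ k : Polynomial F,
      B (Polynomial.aeval H k v) (Polynomial.aeval H g v) = 0) → Polynomial.aeval H g v = 0 := by
    let K : Ideal (Polynomial F) :=
      { carrier := {g | ∀ k : Polynomial F,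
          B (Polynomial.aeval H k v) (Polynomial.aeval H g v) = 0}
        add_mem' := by
          intro a b ha hb k
          rw [map_add, LinearMap.add_apply, hadd, ha k, hb k, add_zero]
        zero_mem' := by
          intro k
          rw [map_zero, LinearMap.zero_apply, h0r]
        smul_mem' := by
          intro c x hx k
          rw [smul_eq_mul, map_mul, Module.End.mul_apply, ← hself, ← Module.End.mul_apply,
            ← map_mul]
          exact hx _ }
    intro g hg
    have hgK : g ∈ K := hg
    obtain ⟨δ, hδ⟩ := (IsPrincipalIdealRing.principal K).principal
    have hmem : ∀ x, x ∈ K ↔ δ ∣ x := by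
      intro x
      rw [hδ]; exact Ideal.mem_span_singleton
    have h1 : δ ∣ φ ^ (e + 1) := by
      rw [← hmem]
      intro k
      rw [hv2, h0r]
    obtain ⟨j, hj, hass⟩ := (dvd_prime_pow hφp _).1 h1
    have h2 : ¬ j ≤ e := by
      intro hje
      have h3 : φ ^ e ∈ K := by
        rw [hmem]
        exact hass.dvd.trans (pow_dvd_pow φ hje)
      have h4 := h3 1
      rw [map_one, Module.End.one_apply, ← hself] at h4
      exact hv1 h4
    have hje : j = e + 1 := by omega
    subst hje
    obtain ⟨c, rfl⟩ := hass.symm.dvd.trans ((hmem g).1 hgK)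
    rw [mul_comm, map_mul, Module.End.mul_apply, hv2, map_zero]
  -- the F-space W0
  let L : Polynomial F →ₗ[F] V :=
    { toFun := fun g => Polynomial.aeval H g v
      map_add' := fun a b => by rw [map_add, LinearMap.add_apply]
      map_smul' := fun a b => by rw [map_smul, LinearMap.smul_apply, RingHom.id_apply] }
  let W0 : Submodule F V := LinearMap.range L
  have hW0 : ∀ x, x ∈ W0 ↔ ∃ g : Polynomial F, Polynomial.aeval H g v = x := fun x => Iff.rfl
  have hW0H : ∀ x ∈ W0, H x ∈ W0 := by
    rintro _ ⟨g, rfl⟩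
    refine (hW0 _).2 ⟨Polynomial.X * g, ?_⟩
    rw [map_mul, Polynomial.aeval_X]; rfl
  have hW0σ : ∀ x ∈ W0, ∀ y ∈ W0, σ (B x y) = B x y := by
    rintro _ ⟨g, rfl⟩ _ ⟨k, rfl⟩
    change σ (B (Polynomial.aeval H g v) (Polynomial.aeval H k v)) =
      B (Polynomial.aeval H g v) (Polynomial.aeval H k v)
    rw [hherm, hself, ← Module.End.mul_apply, ← map_mul, mul_comm, map_mul, Module.End.mul_apply,
      ← hself]
  have hW0nd : ∀ x ∈ W0, (∀ y ∈ W0, B y x = 0) → x = 0 := by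
    rintro _ ⟨g, rfl⟩ h
    exact hgv g (fun k => h _ ⟨k, rfl⟩)
  have hW0sep : ∀ x ∈ W0, ∀ y ∈ W0, (∀ w ∈ W0, B w (x + ι • y) = 0) → x = 0 ∧ y = 0 := by
    intro x hx y hy h
    have h1 : ∀ w ∈ W0, B w x = 0 ∧ B w y = 0 := by
      intro w hw
      apply sep _ _ (hW0σ w hw x hx) (hW0σ w hw y hy)
      rw [← hsmul, ← hadd]; exact h w hw
    exact ⟨hW0nd x hx fun w hw => (h1 w hw).1, hW0nd y hy fun w hw => (h1 w hw).2⟩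
  -- representing functionals
  let fn : V →ₗ[F] (W0 →ₗ[F] E) :=
    { toFun := fun x =>
        { toFun := fun w => B w x
          map_add' := fun a b => by rw [Submodule.coe_add, hadd']
          map_smul' := fun a b => by
            rw [Submodule.coe_smul, hFl, RingHom.id_apply, Algebra.smul_def] }
      map_add' := fun a b => by
        ext w; exact hadd _ _ _
      map_smul' := fun a b => by
        ext w
        change B w (a • b) = a • B w b
        rw [hFr, Algebra.smul_def] }
  let sm : W0 × W0 →ₗ[F] V :=
    { toFun := fun q => (q.1 : V) + ι • (q.2 : V)
      map_add' := fun a b => by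
        simp only [Prod.fst_add, Prod.snd_add, Submodule.coe_add, smul_add]; abel
      map_smul' := fun a b => by
        simp only [Prod.smul_fst, Prod.smul_snd, Submodule.coe_smul, RingHom.id_apply, smul_add]
        rw [hfsm a (ι • (b.2 : V)), hfsm a (b.2 : V), smul_comm] }
  have hinj : Function.Injective (fn.comp sm) := by
    rw [injective_iff_map_eq_zero]
    rintro ⟨x, y⟩ h
    have h1 := hW0sep x x.2 y y.2 (fun w hw => by
      have := congrArg (fun f => f ⟨w, hw⟩) h
      exact this)
    ext
    · exact h1.1
    · exact h1.2
  have hsurj : Function.Surjective (fn.comp sm) := by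
    refine (LinearMap.injective_iff_surjective_of_finrank_eq_finrank ?_).1 hinj
    rw [Module.finrank_prod, Module.finrank_linearMap, hdeg]; ring
  have hdecomp : ∀ x, ∃ w₁ ∈ W0, ∃ w₂ ∈ W0, ∀ w ∈ W0, B w (x - (w₁ + ι • w₂)) = 0 := by
    intro x
    obtain ⟨⟨w1, w2⟩, h⟩ := hsurj (fn x)
    refine ⟨w1, w1.2, w2, w2.2, fun w hw => ?_⟩
    have h1 : B w ((w1 : V) + ι • (w2 : V)) = B w x := congrArg (fun f => f ⟨w, hw⟩) h
    have h2 := hadd w (x - ((w1 : V) + ι • (w2 : V))) ((w1 : V) + ι • (w2 : V))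
    rw [sub_add_cancel, h1] at h2
    linear_combination -h2
  let U : Submodule E V :=
    { carrier := {x | ∀ w ∈ W0, B w x = 0}
      add_mem' := by
        intro a b ha hb w hw
        rw [hadd, ha w hw, hb w hw, add_zero]
      zero_mem' := fun w hw => h0r w
      smul_mem' := by
        intro c x hx w hw
        rw [hsmul, hx w hw, mul_zero] }
  have hUmem : ∀ x, x ∈ U ↔ ∀ w ∈ W0, B w x = 0 := fun x => Iff.rfl
  have hUlt : Module.finrank E U < d := by
    rw [← hd]
    apply Submodule.finrank_lt
    intro htop
    have h1 : v ∈ U := by rw [htop]; trivial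
    exact hv1 (h1 _ ⟨φ ^ e, rfl⟩)
  have hUH : ∀ x ∈ U, H x ∈ U := by
    intro x hx w hw
    rw [← hH]
    exact hx _ (hW0H w hw)
  obtain ⟨WU, hWUH, hWUdec, hWUsep⟩ := ih _ hUlt U rfl (fun x y => B x y)
    (fun x y z => hadd _ _ _) (fun a x y => hsmul _ _ _) (fun x y => hherm _ _)
    (by
      rintro ⟨x, hx⟩ h
      have : x = 0 := by
        apply hnd
        intro y
        obtain ⟨w1, hw1, w2, hw2, hy⟩ := hdecomp y
        have h1 : B (y - (w1 + ι • w2)) x = 0 := h ⟨_, hy⟩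
        have h2 := hadd' (y - (w1 + ι • w2)) (w1 + ι • w2) x
        rw [sub_add_cancel, h1, hadd', hsmul', hx _ hw1, hx _ hw2] at h2
        rw [h2]; ring
      exact Subtype.ext this)
    (H.restrict hUH) (fun x y => hH _ _)
  refine ⟨W0 ⊔ WU.map (U.subtype.restrictScalars F), ?_, ?_, ?_⟩
  · intro w hw
    obtain ⟨a, ha, b, hb, rfl⟩ := Submodule.mem_sup.1 hw
    obtain ⟨b', hb', rfl⟩ := Submodule.mem_map.1 hb
    rw [map_add]
    refine Submodule.add_mem_sup (hW0H a ha) (Submodule.mem_map.2 ⟨_, hWUH b' hb', rfl⟩)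
  · intro x
    obtain ⟨w1, hw1, w2, hw2, hx⟩ := hdecomp x
    obtain ⟨u1, hu1, u2, hu2, hu⟩ := hWUdec ⟨_, hx⟩
    refine ⟨w1 + u1, Submodule.add_mem_sup hw1 (Submodule.mem_map.2 ⟨_, hu1, rfl⟩),
      w2 + u2, Submodule.add_mem_sup hw2 (Submodule.mem_map.2 ⟨_, hu2, rfl⟩), ?_⟩
    have h1 : x - (w1 + ι • w2) = (u1 : V) + ι • (u2 : V) := congrArg Subtype.val hu
    rw [smul_add, ← sub_eq_zero]
    rw [← sub_eq_zero] at h1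
    rw [← h1]; abel
  · intro x hx y hy hxy
    obtain ⟨w1, hw1, b1, hb1, rfl⟩ := Submodule.mem_sup.1 hx
    obtain ⟨u1, hu1, rfl⟩ := Submodule.mem_map.1 hb1
    obtain ⟨w2, hw2, b2, hb2, rfl⟩ := Submodule.mem_sup.1 hy
    obtain ⟨u2, hu2, rfl⟩ := Submodule.mem_map.1 hb2
    change (w1 + (u1 : V)) + ι • (w2 + (u2 : V)) = 0 at hxy
    change w1 + (u1 : V) = 0 ∧ w2 + (u2 : V) = 0
    have h1 := hW0sep w1 hw1 w2 hw2 (fun w hw => by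
      have h2 := congrArg (B w) hxy
      rw [smul_add, hadd, hadd, hadd, hsmul, hsmul, u1.2 w hw, u2.2 w hw, h0r] at h2
      rw [hadd, hsmul]
      linear_combination h2)
    rw [h1.1, h1.2, zero_add, zero_add] at hxy ⊢
    have h2 := hWUsep u1 hu1 u2 hu2 (Subtype.ext hxy)
    rw [h2.1, h2.2]
    exact ⟨rfl, rfl⟩

theorem exists_descent_aux {F E : Type*} [Field F] [Field E] [CharZero E] [Algebra F E]
    (σ : E ≃ₐ[F] E) (hσ2 : ∀ x : E, σ (σ x) = x)
    (hfix : ∀ x : E, σ x = x ↔ x ∈ Set.range (algebraMap F E))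
    (hdeg : Module.finrank F E = 2) (ι : E) (hι : σ ι = -ι) (hι0 : ι ≠ 0) (n : ℕ)
    (H : Matrix (Fin n) (Fin n) E) (hH : (H.map ⇑σ)ᵀ = H) :
    ∃ P : Matrix (Fin n) (Fin n) E, P * P.map ⇑σ = 1 ∧ P * H.map ⇑σ = H * P := by
  classical
  have hH' : ∀ i j, σ (H j i) = H i j := fun i j => congrFun (congrFun hH i) j
  obtain ⟨W, hWH, hWdec, hWsep⟩ := exists_form_aux σ hσ2 hfix hdeg ι hι hι0 _
    (Fin n → E) rfl (fun x y => ∑ i, σ (x i) * y i)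
    (fun x y z => by simp [mul_add, Finset.sum_add_distrib])
    (fun a x y => by
      simp only [Pi.smul_apply, smul_eq_mul, Finset.mul_sum]
      exact Finset.sum_congr rfl fun i _ => by ring)
    (fun x y => by
      rw [map_sum]
      exact Finset.sum_congr rfl fun i _ => by rw [map_mul, hσ2, mul_comm])
    (fun x h => by
      funext i
      have := h (Pi.single i 1)
      simpa [Pi.single_apply, apply_ite] using this)
    (Matrix.mulVecLin H)
    (fun x y => by
      simp only [Matrix.mulVecLin_apply, Matrix.mulVec, dotProduct, map_sum, map_mul,
        Finset.sum_mul, Finset.mul_sum]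
      rw [Finset.sum_comm]
      refine Finset.sum_congr rfl fun i _ => Finset.sum_congr rfl fun j _ => ?_
      rw [hH']; ring)
  choose f₁ hf₁ f₂ hf₂ hf using hWdec
  let J : (Fin n → E) → (Fin n → E) := fun x => f₁ x - ι • f₂ x
  have hJ : ∀ w₁ ∈ W, ∀ w₂ ∈ W, J (w₁ + ι • w₂) = w₁ - ι • w₂ := by
    intro w₁ h₁ w₂ h₂
    have h := hWsep (w₁ - f₁ (w₁ + ι • w₂)) (W.sub_mem h₁ (hf₁ _))
      (w₂ - f₂ (w₁ + ι • w₂)) (W.sub_mem h₂ (hf₂ _)) (by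
        have := hf (w₁ + ι • w₂)
        rw [← sub_eq_zero] at this
        rw [smul_sub, ← this]; abel)
    have e1 := sub_eq_zero.1 h.1
    have e2 := sub_eq_zero.1 h.2
    change f₁ _ - ι • f₂ _ = _
    rw [← e1, ← e2]
  have hJadd : ∀ x y, J (x + y) = J x + J y := by
    intro x y
    have h1 := hJ (f₁ x + f₁ y) (W.add_mem (hf₁ x) (hf₁ y)) (f₂ x + f₂ y)
      (W.add_mem (hf₂ x) (hf₂ y))
    have h2 : f₁ x + f₁ y + ι • (f₂ x + f₂ y) = x + y := by
      conv_rhs => rw [hf x, hf y]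
      rw [smul_add]; abel
    rw [h2] at h1
    rw [h1]
    change _ = (f₁ x - ι • f₂ x) + (f₁ y - ι • f₂ y)
    rw [smul_add]; abel
  have hfixE : ∀ a : E, σ a = a → ∃ b : F, algebraMap F E b = a := fun a ha => (hfix a).1 ha
  have hJsmul : ∀ (a : E) x, J (a • x) = σ a • J x := by
    intro a x
    obtain ⟨c, hc⟩ := hfixE (ι * ι) (by rw [map_mul, hι]; ring)
    obtain ⟨a₁, ha₁⟩ := hfixE ((a + σ a) / 2) (by
      rw [map_div₀, map_add, hσ2, map_ofNat, add_comm])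
    obtain ⟨a₂, ha₂⟩ := hfixE ((a - σ a) / (2 * ι)) (by
      rw [map_div₀, map_sub, hσ2, map_mul, map_ofNat, hι]; field_simp; ring)
    have ha : a = algebraMap F E a₁ + ι * algebraMap F E a₂ := by
      rw [ha₁, ha₂]; field_simp; ring
    have hσa : σ a = algebraMap F E a₁ - ι * algebraMap F E a₂ := by
      rw [ha₁, ha₂]; field_simp; ring
    have h1 := hJ (a₁ • f₁ x + (c * a₂) • f₂ x)
      (W.add_mem (W.smul_mem _ (hf₁ x)) (W.smul_mem _ (hf₂ x)))
      (a₁ • f₂ x + a₂ • f₁ x)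
      (W.add_mem (W.smul_mem _ (hf₂ x)) (W.smul_mem _ (hf₁ x)))
    have h2 : a₁ • f₁ x + (c * a₂) • f₂ x + ι • (a₁ • f₂ x + a₂ • f₁ x) = a • x := by
      conv_rhs => rw [hf x, ha]
      funext i
      simp only [Pi.add_apply, Pi.smul_apply]
      simp only [Algebra.smul_def, map_mul, hc, Algebra.algebraMap_self, RingHom.id_apply]
      ring
    rw [h2] at h1
    rw [h1, hσa]
    change _ = _ • (f₁ x - ι • f₂ x)
    funext i
    simp only [Pi.add_apply, Pi.sub_apply, Pi.smul_apply]
    simp only [Algebra.smul_def, map_mul, hc, Algebra.algebraMap_self, RingHom.id_apply]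
    ring
  have hJJ : ∀ x, J (J x) = x := by
    intro x
    have h1 := hJ (f₁ x) (hf₁ x) (-f₂ x) (W.neg_mem (hf₂ x))
    have h2 : J x = f₁ x + ι • (-f₂ x) := by rw [smul_neg, ← sub_eq_add_neg]
    rw [h2, h1, smul_neg, sub_neg_eq_add, ← hf x]
  have hJH : ∀ x, J (H *ᵥ x) = H *ᵥ (J x) := by
    intro x
    have h1 := hJ (H *ᵥ f₁ x) (hWH _ (hf₁ x)) (H *ᵥ f₂ x) (hWH _ (hf₂ x))
    rw [← Matrix.mulVec_smul, ← Matrix.mulVec_add, ← Matrix.mulVec_sub, ← hf x] at h1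
    exact h1
  let Jh : (Fin n → E) →+ (Fin n → E) := AddMonoidHom.mk' J hJadd
  let P : Matrix (Fin n) (Fin n) E := Matrix.of fun i j => J (Pi.single j 1) i
  have hP : ∀ v : Fin n → E, P *ᵥ (fun j => σ (v j)) = J v := by
    intro v
    have h1 : v = ∑ j, v j • (Pi.single j 1 : Fin n → E) := by
      funext i
      simp [Finset.sum_apply, Pi.single_apply]
    have h2 : J v = ∑ j, σ (v j) • J (Pi.single j 1) := by
      have : Jh v = ∑ j, Jh (v j • (Pi.single j 1 : Fin n → E)) := by
        rw [← map_sum, ← h1]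
      exact this.trans (Finset.sum_congr rfl fun j _ => hJsmul _ _)
    rw [h2]
    funext i
    simp only [Matrix.mulVec, dotProduct, Finset.sum_apply, Pi.smul_apply, smul_eq_mul]
    exact Finset.sum_congr rfl fun j _ => mul_comm _ _
  refine ⟨P, ?_, ?_⟩
  · ext i j
    have h1 := congrFun (hP (J (Pi.single j 1))) i
    rw [hJJ] at h1
    have h3 : (1 : Matrix (Fin n) (Fin n) E) i j = (Pi.single j 1 : Fin n → E) i := by
      rw [Matrix.one_apply, Pi.single_apply]
    exact h1.trans h3.symm
  · ext i j
    have h1 := congrFun (hP (H *ᵥ (Pi.single j 1))) i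
    rw [hJH] at h1
    have h2 : H *ᵥ (Pi.single j 1) = fun k => H k j := by
      rw [Matrix.mulVec_single_one]; rfl
    rw [h2] at h1
    exact h1

theorem norm_matrix_aux (p : ℕ) [Fact p.Prime] {O : Type*} [CommRing O] [Algebra ℤ_[p] O]
    [Module.Finite ℤ_[p] O] [Module.Free ℤ_[p] O] (n : ℕ)
    (H H' : Matrix (Fin n) (Fin n) O) (h1 : H * H' = 1) (h2 : H' * H = 1)
    (t s D : O) (hD : (t ^ 2 - 4 * s) * D = 1) :
    ∃ a b : Matrix (Fin n) (Fin n) O,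
      a ∈ Algebra.adjoin ℤ_[p] ({H, H', Matrix.scalar (Fin n) t, Matrix.scalar (Fin n) s,
        Matrix.scalar (Fin n) D} : Set (Matrix (Fin n) (Fin n) O)) ∧
      b ∈ Algebra.adjoin ℤ_[p] ({H, H', Matrix.scalar (Fin n) t, Matrix.scalar (Fin n) s,
        Matrix.scalar (Fin n) D} : Set (Matrix (Fin n) (Fin n) O)) ∧
      a * b = b * a ∧
      a * a + t • (a * b) + s • (b * b) = H := by
  classical
  set S : Set (Matrix (Fin n) (Fin n) O) := {H, H', Matrix.scalar (Fin n) t,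
    Matrix.scalar (Fin n) s, Matrix.scalar (Fin n) D} with hS
  have hsc : ∀ (r : O) (M : Matrix (Fin n) (Fin n) O),
      Matrix.scalar (Fin n) r * M = M * Matrix.scalar (Fin n) r := fun r M =>
    (Matrix.scalar_commute r (fun r' => mul_comm r r') M).eq
  have hcomm : ∀ a ∈ S, ∀ b ∈ S, a * b = b * a := by
    intro a ha b hb
    simp only [hS, Set.mem_insert_iff, Set.mem_singleton_iff] at ha hb
    rcases ha with rfl | rfl | rfl | rfl | rfl
    · rcases hb with rfl | rfl | rfl | rfl | rfl
      · rfl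
      · rw [h1, h2]
      · rw [hsc]
      · rw [hsc]
      · rw [hsc]
    · rcases hb with rfl | rfl | rfl | rfl | rfl
      · rw [h1, h2]
      · rfl
      · rw [hsc]
      · rw [hsc]
      · rw [hsc]
    · rw [hsc]
    · rw [hsc]
    · rw [hsc]
  letI := Algebra.adjoinCommRingOfComm ℤ_[p] hcomm
  have hfin : Module.Finite ℤ_[p] (Algebra.adjoin ℤ_[p] S) :=
    inferInstanceAs (Module.Finite ℤ_[p] (Subalgebra.toSubmodule (Algebra.adjoin ℤ_[p] S)))
  have hfree : Module.Free ℤ_[p] (Algebra.adjoin ℤ_[p] S) :=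
    inferInstanceAs (Module.Free ℤ_[p] (Subalgebra.toSubmodule (Algebra.adjoin ℤ_[p] S)))
  have hm : ∀ x ∈ S, x ∈ Algebra.adjoin ℤ_[p] S := fun x hx => Algebra.subset_adjoin hx
  obtain ⟨a, b, hab⟩ := norm_padic_aux p (R := Algebra.adjoin ℤ_[p] S)
    ⟨Matrix.scalar (Fin n) t, hm _ (by simp [hS])⟩
    ⟨Matrix.scalar (Fin n) s, hm _ (by simp [hS])⟩
    ⟨Matrix.scalar (Fin n) D, hm _ (by simp [hS])⟩
    ⟨H, hm _ (by simp [hS])⟩ ⟨H', hm _ (by simp [hS])⟩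
    (by
      apply Subtype.ext
      change (Matrix.scalar (Fin n) t ^ 2 - 4 * Matrix.scalar (Fin n) s) *
        Matrix.scalar (Fin n) D = 1
      rw [← map_ofNat (Matrix.scalar (Fin n)) 4, ← map_pow, ← map_mul, ← map_sub, ← map_mul, hD,
        map_one])
    (Subtype.ext h1)
  refine ⟨a, b, a.2, b.2, congrArg Subtype.val (mul_comm a b), ?_⟩
  have := congrArg Subtype.val hab
  change (a : Matrix (Fin n) (Fin n) O) ^ 2 + Matrix.scalar (Fin n) t * a * b +
    Matrix.scalar (Fin n) s * (b : Matrix (Fin n) (Fin n) O) ^ 2 = H at this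
  rw [← this, pow_two, pow_two, mul_assoc, Matrix.scalar_apply, Matrix.scalar_apply,
    ← Matrix.smul_eq_diagonal_mul, ← Matrix.smul_eq_diagonal_mul]

theorem twisted_norm_of_integral_is_norm
    (p : ℕ) [Fact p.Prime] {F E : Type*} [Field F] [Field E]
    [Algebra ℚ_[p] F] [Algebra ℚ_[p] E] [Algebra F E] [IsScalarTower ℚ_[p] F E]
    [FiniteDimensional ℚ_[p] F] [FiniteDimensional ℚ_[p] E]
    [Algebra ℤ_[p] F] [Algebra ℤ_[p] E]
    [IsScalarTower ℤ_[p] ℚ_[p] F] [IsScalarTower ℤ_[p] ℚ_[p] E]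
    (σ : E ≃ₐ[F] E)
    (hσ2 : ∀ x : E, σ (σ x) = x)
    (hfix : ∀ x : E, σ x = x ↔ x ∈ Set.range (algebraMap F E))
    (hdeg : Module.finrank F E = 2)
    -- unramifiedness: some uniformizer of O_F remains irreducible in O_E
    (hunr : ∃ (π : F) (hπ : π ∈ integralClosure ℤ_[p] F)
      (hπE : algebraMap F E π ∈ integralClosure ℤ_[p] E),
      Irreducible (⟨π, hπ⟩ : integralClosure ℤ_[p] F) ∧
      Irreducible (⟨algebraMap F E π, hπE⟩ : integralClosure ℤ_[p] E))
    (n : ℕ) (hn : 1 ≤ n)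
    (ζ : Matrix (Fin n) (Fin n) E) (hζ : InGLnO p ζ) :
    ∃ γ : Matrix (Fin n) (Fin n) E, IsUnit γ ∧
      (ζ.map ⇑σ)ᵀ * ζ = (γ.map ⇑σ) * γ := by
  classical
  obtain ⟨π, hπF, hπE, -, hπirr⟩ := hunr
  have hz : ∀ z : ℤ_[p], algebraMap ℤ_[p] E z =
      algebraMap F E (algebraMap ℚ_[p] F (algebraMap ℤ_[p] ℚ_[p] z)) := by
    intro z
    rw [← IsScalarTower.algebraMap_apply ℚ_[p] F E, ← IsScalarTower.algebraMap_apply ℤ_[p] ℚ_[p] E]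
  have hσz : ∀ z : ℤ_[p], σ (algebraMap ℤ_[p] E z) = algebraMap ℤ_[p] E z := by
    intro z
    rw [hz, AlgEquiv.commutes]
  let σZ : E →ₐ[ℤ_[p]] E := { (σ : E →+* E) with commutes' := hσz }
  have hσint : ∀ x ∈ integralClosure ℤ_[p] E, σ x ∈ integralClosure ℤ_[p] E :=
    fun x hx => IsIntegral.map σZ hx
  have hchar : CharZero E := charZero_of_injective_algebraMap (algebraMap ℚ_[p] E).injective
  have hinj : Function.Injective (algebraMap ℤ_[p] E) := by
    rw [IsScalarTower.algebraMap_eq ℤ_[p] ℚ_[p] E]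
    exact (algebraMap ℚ_[p] E).injective.comp (IsFractionRing.injective ℤ_[p] ℚ_[p])
  have hfaith : FaithfulSMul ℤ_[p] E := (faithfulSMul_iff_algebraMap_injective _ _).2 hinj
  have htf : Module.IsTorsionFree ℤ_[p] E := inferInstance
  have hfr : IsFractionRing (integralClosure ℤ_[p] E) E :=
    integralClosure.isFractionRing_of_finite_extension ℚ_[p] E
  have hfin : Module.Finite ℤ_[p] (integralClosure ℤ_[p] E) :=
    IsIntegralClosure.finite ℤ_[p] ℚ_[p] E (integralClosure ℤ_[p] E)
  have hfree : Module.Free ℤ_[p] (integralClosure ℤ_[p] E) :=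
    IsIntegralClosure.module_free ℤ_[p] ℚ_[p] E (integralClosure ℤ_[p] E)
  have hded : IsDedekindDomain (integralClosure ℤ_[p] E) :=
    integralClosure.isDedekindDomain ℤ_[p] ℚ_[p] E
  let σO : integralClosure ℤ_[p] E →ₐ[ℤ_[p]] integralClosure ℤ_[p] E :=
    (σZ.comp (integralClosure ℤ_[p] E).val).codRestrict (integralClosure ℤ_[p] E)
      (fun x => hσint _ x.2)
  have hσO : ∀ x : integralClosure ℤ_[p] E, ((σO x : integralClosure ℤ_[p] E) : E) = σ (x : E) :=
    fun x => rfl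
  have hneE : ∃ x : E, σ x ≠ x := by
    by_contra! hcon
    have hb : (⊥ : Subalgebra F E) = ⊤ := by
      rw [eq_top_iff]
      intro x _
      exact Algebra.mem_bot.2 ((hfix x).1 (hcon x))
    have h1 := Subalgebra.finrank_bot (F := F) (E := E)
    rw [hb, subalgebra_top_finrank_eq_submodule_top_finrank, finrank_top, hdeg] at h1
    omega
  have hneO : ∃ x : integralClosure ℤ_[p] E, σO x ≠ x := by
    obtain ⟨x, hx⟩ := hneE
    by_contra! hcon
    apply hx
    obtain ⟨u, v, hv, rfl⟩ := IsFractionRing.div_surjective (A := integralClosure ℤ_[p] E) x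
    have h1 : σ (u : E) = u := by rw [← hσO, hcon]
    have h2 : σ (v : E) = v := by rw [← hσO, hcon]
    change σ ((u : E) / (v : E)) = (u : E) / (v : E)
    rw [map_div₀, h1, h2]
  obtain ⟨θ, hθ⟩ := exists_theta_aux p (integralClosure ℤ_[p] E) (σO : _ →+* _)
    (fun x => Subtype.ext (hσ2 x)) ⟨_, hπE⟩ hπirr (Subtype.ext (AlgEquiv.commutes σ π)) hneO
  change IsUnit (θ - σO θ) at hθ
  have hσO2 : ∀ x, σO (σO x) = x := fun x => Subtype.ext (hσ2 x)
  obtain ⟨u, hu⟩ := isUnit_iff_exists_inv.1 hθ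
  set t := θ + σO θ with ht
  set s := θ * σO θ with hs
  have hD : (t ^ 2 - 4 * s) * u ^ 2 = 1 := by
    have : (t ^ 2 - 4 * s) * u ^ 2 = ((θ - σO θ) * u) ^ 2 := by rw [ht, hs]; ring
    rw [this, hu, one_pow]
  have hσt : σO t = t := by rw [ht, map_add, hσO2, add_comm]
  have hσs : σO s = s := by rw [hs, map_mul, hσO2, mul_comm]
  have hσD : σO (u ^ 2) = u ^ 2 := by
    have h1 := congrArg σO hD
    rw [map_mul, map_sub, map_pow, map_mul, hσt, hσs, map_ofNat, map_one] at h1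
    calc σO (u ^ 2) = σO (u ^ 2) * ((t ^ 2 - 4 * s) * u ^ 2) := by rw [hD, mul_one]
      _ = ((t ^ 2 - 4 * s) * σO (u ^ 2)) * u ^ 2 := by ring
      _ = u ^ 2 := by rw [h1, one_mul]
  -- the Hermitian matrix
  obtain ⟨hζ1, ξ, hξ1, hζξ, hξζ⟩ := hζ
  have hmapmul : ∀ A B : Matrix (Fin n) (Fin n) E,
      (A * B).map ⇑σ = A.map ⇑σ * B.map ⇑σ := fun A B =>
    Matrix.map_mul (f := (σ : E →+* E))
  have hmapone : (1 : Matrix (Fin n) (Fin n) E).map ⇑σ = 1 :=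
    Matrix.map_one _ (map_zero σ) (map_one σ)
  have hmapmap : ∀ A : Matrix (Fin n) (Fin n) E, (A.map ⇑σ).map ⇑σ = A := by
    intro A; ext i j; exact hσ2 _
  let O := integralClosure ℤ_[p] E
  let ζO : Matrix (Fin n) (Fin n) O := Matrix.of fun i j => ⟨ζ i j, hζ1 i j⟩
  let ξO : Matrix (Fin n) (Fin n) O := Matrix.of fun i j => ⟨ξ i j, hξ1 i j⟩
  let c : Matrix (Fin n) (Fin n) O →ₐ[ℤ_[p]] Matrix (Fin n) (Fin n) E :=
    AlgHom.mapMatrix (integralClosure ℤ_[p] E).val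
  have hcinj : Function.Injective c := by
    intro A B hAB
    ext i j
    exact congrFun (congrFun hAB i) j
  let τ : Matrix (Fin n) (Fin n) O →ₐ[ℤ_[p]] Matrix (Fin n) (Fin n) O := AlgHom.mapMatrix σO
  have hcτ : ∀ A, c (τ A) = (c A).map ⇑σ := fun A => rfl
  have hcζ : c ζO = ζ := rfl
  have hcξ : c ξO = ξ := rfl
  have hζξO : ζO * ξO = 1 := hcinj (by rw [map_mul, map_one, hcζ, hcξ, hζξ])
  have hξζO : ξO * ζO = 1 := hcinj (by rw [map_mul, map_one, hcζ, hcξ, hξζ])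
  have hτ1 : (τ ζO)ᵀ * (τ ξO)ᵀ = 1 := by
    rw [← Matrix.transpose_mul, ← map_mul, hξζO, map_one, Matrix.transpose_one]
  have hτ2 : (τ ξO)ᵀ * (τ ζO)ᵀ = 1 := by
    rw [← Matrix.transpose_mul, ← map_mul, hζξO, map_one, Matrix.transpose_one]
  obtain ⟨a, b, ha, hb, hab, hN⟩ := norm_matrix_aux p n ((τ ζO)ᵀ * ζO) (ξO * (τ ξO)ᵀ)
    (by rw [Matrix.mul_assoc, ← Matrix.mul_assoc ζO, hζξO, Matrix.one_mul, hτ1])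
    (by rw [Matrix.mul_assoc, ← Matrix.mul_assoc _ _ ζO, hτ2, Matrix.one_mul, hξζO])
    t s (u ^ 2) hD
  set H : Matrix (Fin n) (Fin n) E := (ζ.map ⇑σ)ᵀ * ζ with hHdef
  set H' : Matrix (Fin n) (Fin n) E := ξ * (ξ.map ⇑σ)ᵀ with hHdef'
  have hcH : c ((τ ζO)ᵀ * ζO) = H := by rw [map_mul]; rfl
  have hcH' : c (ξO * (τ ξO)ᵀ) = H' := by rw [map_mul]; rfl
  have hHH' : H * H' = 1 := by
    rw [← hcH, ← hcH', ← map_mul, Matrix.mul_assoc, ← Matrix.mul_assoc ζO, hζξO, Matrix.one_mul,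
      hτ1, map_one]
  have hH'H : H' * H = 1 := by
    rw [← hcH, ← hcH', ← map_mul, Matrix.mul_assoc, ← Matrix.mul_assoc _ _ ζO, hτ2,
      Matrix.one_mul, hξζO, map_one]
  have hHherm : (H.map ⇑σ)ᵀ = H := by
    rw [hHdef, hmapmul, Matrix.transpose_mul, Matrix.transpose_map, Matrix.transpose_transpose,
      hmapmap]
  have hι : σ ((θ - σO θ : O) : E) = -((θ - σO θ : O) : E) := by
    rw [← hσO, map_sub, hσO2, ← neg_sub]; rfl
  have hι0 : ((θ - σO θ : O) : E) ≠ 0 := by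
    intro h
    exact hθ.ne_zero (Subtype.ext h)
  obtain ⟨P, hPP, hPH⟩ := exists_descent_aux σ hσ2 hfix hdeg _ hι hι0 n H hHherm
  have hPH' : P * H'.map ⇑σ = H' * P := by
    have e : H.map ⇑σ * H'.map ⇑σ = 1 := by rw [← hmapmul, hHH', hmapone]
    calc P * H'.map ⇑σ = H' * H * P * H'.map ⇑σ := by rw [hH'H, Matrix.one_mul]
      _ = H' * (H * P) * H'.map ⇑σ := by simp only [Matrix.mul_assoc]
      _ = H' * P * (H.map ⇑σ * H'.map ⇑σ) := by rw [← hPH]; simp only [Matrix.mul_assoc]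
      _ = H' * P := by rw [e, Matrix.mul_one]
  have hsc : ∀ r : O, σO r = r →
      P * (c (Matrix.scalar (Fin n) r)).map ⇑σ = c (Matrix.scalar (Fin n) r) * P := by
    intro r hr
    have e1 : c (Matrix.scalar (Fin n) r) = Matrix.scalar (Fin n) (r : E) := by
      ext i j
      change ((Matrix.diagonal (fun _ => r) i j : O) : E) = Matrix.diagonal (fun _ => (r : E)) i j
      rw [Matrix.diagonal_apply, Matrix.diagonal_apply]
      split_ifs <;> rfl
    have e2 : τ (Matrix.scalar (Fin n) r) = Matrix.scalar (Fin n) r := by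
      ext i j
      change ((σO (Matrix.diagonal (fun _ => r) i j) : O) : E) =
        ((Matrix.diagonal (fun _ => r) i j : O) : E)
      rw [Matrix.diagonal_apply]
      split_ifs
      · rw [hr]
      · rw [map_zero]
    rw [← hcτ, e2, e1]
    exact (Matrix.scalar_commute (r : E) (fun r' => mul_comm _ r') P).eq.symm
  have hP : ∀ M ∈ Algebra.adjoin ℤ_[p] ({(τ ζO)ᵀ * ζO, ξO * (τ ξO)ᵀ, Matrix.scalar (Fin n) t,
      Matrix.scalar (Fin n) s, Matrix.scalar (Fin n) (u ^ 2)} : Set (Matrix (Fin n) (Fin n) O)),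
      P * (c M).map ⇑σ = c M * P := by
    intro M hM
    induction hM using Algebra.adjoin_induction with
    | mem x hx =>
      simp only [Set.mem_insert_iff, Set.mem_singleton_iff] at hx
      rcases hx with rfl | rfl | rfl | rfl | rfl
      · rw [hcH, hPH]
      · rw [hcH', hPH']
      · exact hsc _ hσt
      · exact hsc _ hσs
      · exact hsc _ hσD
    | algebraMap r =>
      rw [← hcτ, AlgHom.commutes, AlgHom.commutes]
      exact (Algebra.commutes r P).symm
    | add x y _ _ hx hy =>
      rw [← hcτ, map_add, map_add, map_add, hcτ, hcτ, Matrix.mul_add, hx, hy, Matrix.add_mul]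
    | mul x y _ _ hx hy =>
      rw [map_mul, hmapmul, ← Matrix.mul_assoc, hx, Matrix.mul_assoc, hy, Matrix.mul_assoc]
  have hPa := hP a ha
  have hPb := hP b hb
  -- the norm equation over `E`
  set x : E := (θ : E) with hx
  have hcsm : ∀ (r : O) (M : Matrix (Fin n) (Fin n) O), c (r • M) = (r : E) • c M := by
    intro r M; ext i j; rfl
  have hNE : c a * c a + (x + σ x) • (c a * c b) + (x * σ x) • (c b * c b) = H := by
    rw [← hcH, ← hN, map_add, map_add, hcsm, hcsm, map_mul, map_mul, map_mul]
    rfl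
  have habE : c a * c b = c b * c a := by rw [← map_mul, hab, map_mul]
  let Γ : Matrix (Fin n) (Fin n) E := (c a + x • c b) * P
  have hmapadd : (c a + x • c b).map ⇑σ = (c a).map ⇑σ + σ x • (c b).map ⇑σ := by
    ext i j
    exact (map_add σ _ _).trans (congrArg _ (map_mul σ _ _))
  have hΓ : Γ * Γ.map ⇑σ = H := by
    change (c a + x • c b) * P * ((c a + x • c b) * P).map ⇑σ = H
    rw [hmapmul, hmapadd]
    have e1 : P * ((c a).map ⇑σ + σ x • (c b).map ⇑σ) = (c a + σ x • c b) * P := by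
      rw [Matrix.mul_add, Matrix.mul_smul, hPa, hPb, Matrix.add_mul, Matrix.smul_mul]
    rw [Matrix.mul_assoc, ← Matrix.mul_assoc P, e1, Matrix.mul_assoc, hPP, Matrix.mul_one, ← hNE,
      Matrix.add_mul, Matrix.mul_add, Matrix.mul_add, Matrix.mul_smul, Matrix.smul_mul,
      Matrix.smul_mul, Matrix.mul_smul, smul_smul, ← habE, add_smul]
    abel
  refine ⟨Γ.map ⇑σ, ?_, ?_⟩
  · rw [Matrix.isUnit_iff_isUnit_det]
    have h1 : Γ.det * (Γ.map ⇑σ).det * H'.det = 1 := by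
      rw [← Matrix.det_mul, hΓ, ← Matrix.det_mul, hHH', Matrix.det_one]
    exact IsUnit.of_mul_eq_one (Γ.det * H'.det) (by rw [← h1]; ring)
  · rw [hmapmap, hΓ]
end

section
/- There is a bijection between [X_rss] and the disjoint union, over similarity classes of skew-Hermitian matrices β ∈ GL_n(E), of the sets [Y^β_rss], under which a class [γ, x, y] ∈ [X_rss] corresponds to a class [ζ, z] ∈ [Y^β_rss] if and only if the triples [σ(γ)γ, x, y] and [β⁻¹ζ*βζ, z, β⁻¹z*] lie in the same GL_n(E)-orbit of M_n(E). -/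
/-!
STATEMENT 13: The matching relation (same GL_n(E)-orbit of associated triples in
M_n(E)) induces a bijection between [X_rss] and the disjoint union over similarity
classes of skew-Hermitian β (represented by a set B of representatives) of the
sets [Y^β_rss].

The bijection of equivalence classes is expressed relationally: the matching
relation is total and co-total on regular semisimple elements, is invariant under
the equivalences on both sides, and identifies classes uniquely in both
directions.  This is precisely the assertion that matching descends to a
bijection [X_rss] ≃ ⨿_β [Y^β_rss] with the required property.
-/

open Matrix

/-- A square matrix over a field `E` is regular semisimple if its characteristic
polynomial has `n` distinct roots in an algebraic closure of `E`. -/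
def IsRegSemisimple {n : ℕ} {E : Type*} [Field E] (A : Matrix (Fin n) (Fin n) E) : Prop :=
  Multiset.card ((A.charpoly.map (algebraMap E (AlgebraicClosure E))).roots) = n ∧
    ((A.charpoly.map (algebraMap E (AlgebraicClosure E))).roots).Nodup

/-- A triple `[ξ, x, y] ∈ M_n(E)` is regular semisimple. -/
def TripleRegSemisimple {n : ℕ} {E : Type*} [Field E]
    (ξ : Matrix (Fin n) (Fin n) E) (x y : Fin n → E) : Prop :=
  IsRegSemisimple ξ ∧
    Submodule.span E (Set.range fun k : Fin n => Matrix.vecMul x (ξ ^ (k : ℕ))) = ⊤ ∧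
    Submodule.span E (Set.range fun k : Fin n => Matrix.mulVec (ξ ^ (k : ℕ)) y) = ⊤

section

variable {F E : Type*} [Field F] [Field E] [Algebra F E]

/-- The twisted norm `β⁻¹ ζ* β ζ` on the unitary side. -/
noncomputable def nuMat (σ : E ≃ₐ[F] E) {n : ℕ} (β ζ : Matrix (Fin n) (Fin n) E) :
    Matrix (Fin n) (Fin n) E :=
  β⁻¹ * (ζ.map ⇑σ)ᵀ * β * ζ

/-- Membership in the unitary group `U_n^β(F)`. -/
def InUnitary (σ : E ≃ₐ[F] E) {n : ℕ} (β h : Matrix (Fin n) (Fin n) E) : Prop :=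
  IsUnit h ∧ (h.map ⇑σ)ᵀ * β * h = β

/-- An element `[γ, x, y]` of `X = S × F_n × (F⁻)ⁿ` which is regular semisimple. -/
def XrssElt (σ : E ≃ₐ[F] E) {n : ℕ} (S : Set (Matrix (Fin n) (Fin n) E))
    (t : Matrix (Fin n) (Fin n) E × (Fin n → E) × (Fin n → E)) : Prop :=
  t.1 ∈ S ∧ (∀ i, t.2.1 i ∈ Set.range (algebraMap F E)) ∧
    (∀ i, σ (t.2.2 i) = - t.2.2 i) ∧
    TripleRegSemisimple ((t.1.map ⇑σ) * t.1) t.2.1 t.2.2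

/-- Equivalence on `X`: same `γ ∈ S`, and `[x, y]` in the same `T_γ`-orbit. -/
def XEquiv (σ : E ≃ₐ[F] E) {n : ℕ}
    (t t' : Matrix (Fin n) (Fin n) E × (Fin n → E) × (Fin n → E)) : Prop :=
  t.1 = t'.1 ∧ ∃ g : Matrix (Fin n) (Fin n) E, IsUnit g ∧
    g⁻¹ * t.1 * g.map ⇑σ = t.1 ∧
    Matrix.vecMul t.2.1 g = t'.2.1 ∧ Matrix.mulVec g⁻¹ t.2.2 = t'.2.2

/-- An element `[β; ζ, z]` with `β ∈ B`, `ζ ∈ R^β`, `[ζ, z] ∈ Y^β` regular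
semisimple. -/
def YrssElt (σ : E ≃ₐ[F] E) {n : ℕ} (B : Set (Matrix (Fin n) (Fin n) E))
    (R : Matrix (Fin n) (Fin n) E → Set (Matrix (Fin n) (Fin n) E))
    (q : Matrix (Fin n) (Fin n) E × Matrix (Fin n) (Fin n) E × (Fin n → E)) : Prop :=
  q.1 ∈ B ∧ q.2.1 ∈ R q.1 ∧
    TripleRegSemisimple (nuMat σ q.1 q.2.1) q.2.2
      (Matrix.mulVec q.1⁻¹ fun i => σ (q.2.2 i))

/-- Equivalence on `Y^β`: same `β`, same `ζ`, and `z` in the same orbit under the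
centralizer of `ζ` in `U_n^β(F)`. -/
def YEquiv (σ : E ≃ₐ[F] E) {n : ℕ}
    (q q' : Matrix (Fin n) (Fin n) E × Matrix (Fin n) (Fin n) E × (Fin n → E)) : Prop :=
  q.1 = q'.1 ∧ q.2.1 = q'.2.1 ∧ ∃ u : Matrix (Fin n) (Fin n) E,
    InUnitary σ q.1 u ∧ u * q.2.1 = q.2.1 * u ∧ Matrix.vecMul q.2.2 u = q'.2.2

/-- `[γ, x, y]` and `[β; ζ, z]` match: the triples `[σ(γ)γ, x, y]` and
`[β⁻¹ζ*βζ, z, β⁻¹z*]` lie in the same `GL_n(E)`-orbit of `M_n(E)`. -/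
def MatchXY (σ : E ≃ₐ[F] E) {n : ℕ}
    (t : Matrix (Fin n) (Fin n) E × (Fin n → E) × (Fin n → E))
    (q : Matrix (Fin n) (Fin n) E × Matrix (Fin n) (Fin n) E × (Fin n → E)) : Prop :=
  ∃ h : Matrix (Fin n) (Fin n) E, IsUnit h ∧
    h⁻¹ * ((t.1.map ⇑σ) * t.1) * h = nuMat σ q.1 q.2.1 ∧
    Matrix.vecMul t.2.1 h = q.2.2 ∧
    Matrix.mulVec h⁻¹ t.2.2 = Matrix.mulVec q.1⁻¹ fun i => σ (q.2.2 i)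

end


section Helpers

variable {F E : Type*} [Field F] [Field E] [Algebra F E] {n : ℕ}

/-- Krylov matrix with rows `x N^k`. -/
def KM (N : Matrix (Fin n) (Fin n) E) (x : Fin n → E) : Matrix (Fin n) (Fin n) E :=
  Matrix.of fun k : Fin n => x ᵥ* (N ^ (k : ℕ))

lemma KM_row (N : Matrix (Fin n) (Fin n) E) (x : Fin n → E) (k : Fin n) :
    (KM N x) k = x ᵥ* (N ^ (k : ℕ)) := rfl

lemma isUnit_KM_iff (N : Matrix (Fin n) (Fin n) E) (x : Fin n → E) :
    Submodule.span E (Set.range fun k : Fin n => x ᵥ* (N ^ (k : ℕ))) = ⊤ ↔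
      IsUnit (KM N x) := by
  rw [← Matrix.linearIndependent_rows_iff_isUnit]
  change _ ↔ LinearIndependent E (fun k : Fin n => x ᵥ* (N ^ (k : ℕ)))
  constructor
  · intro h
    exact linearIndependent_of_top_le_span_of_card_eq_finrank h.ge (by simp)
  · intro h
    exact h.span_eq_top_of_card_eq_finrank' (by simp)

lemma triple_iff (N : Matrix (Fin n) (Fin n) E) (x y : Fin n → E) :
    TripleRegSemisimple N x y ↔
      IsRegSemisimple N ∧ IsUnit (KM N x) ∧ IsUnit (KM Nᵀ y) := by
  unfold TripleRegSemisimple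
  rw [isUnit_KM_iff, ← isUnit_KM_iff Nᵀ y]
  simp only [← Matrix.transpose_pow, Matrix.vecMul_transpose]

lemma semi_pow {N N' h : Matrix (Fin n) (Fin n) E} (e : N * h = h * N') (k : ℕ) :
    N ^ k * h = h * N' ^ k := by
  have : SemiconjBy h N' N := e.symm
  exact (this.pow_right k).symm

lemma KM_mul {N N' h : Matrix (Fin n) (Fin n) E} (e : N * h = h * N') (x : Fin n → E) :
    KM N x * h = KM N' (x ᵥ* h) := by
  funext k
  rw [Matrix.mul_apply_eq_vecMul, KM_row, KM_row, Matrix.vecMul_vecMul, semi_pow e,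
    Matrix.vecMul_vecMul]

lemma uniq {N N' M M' : Matrix (Fin n) (Fin n) E} {x : Fin n → E} (hx : IsUnit (KM N x))
    (e : N * M = M * N') (e' : N * M' = M' * N') (h : x ᵥ* M = x ᵥ* M') : M = M' := by
  apply hx.mul_left_cancel
  rw [KM_mul e, KM_mul e', h]

/-- Polynomial in `N` of degree `< n`. -/
def PM (N : Matrix (Fin n) (Fin n) E) (c : Fin n → E) : Matrix (Fin n) (Fin n) E :=
  ∑ k, c k • N ^ (k : ℕ)

lemma PM_semi {N N' h : Matrix (Fin n) (Fin n) E} (e : N * h = h * N') (c : Fin n → E) :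
    PM N c * h = h * PM N' c := by
  simp only [PM, Finset.sum_mul, Finset.mul_sum, smul_mul_assoc, mul_smul_comm, semi_pow e]

lemma exists_PM {N : Matrix (Fin n) (Fin n) E} {x : Fin n → E} (hx : IsUnit (KM N x))
    (x' : Fin n → E) : ∃ c, x ᵥ* PM N c = x' := by
  refine ⟨x' ᵥ* (KM N x)⁻¹, ?_⟩
  have h1 : x' = (x' ᵥ* (KM N x)⁻¹) ᵥ* KM N x := by
    rw [Matrix.vecMul_vecMul, Matrix.nonsing_inv_mul _ ((Matrix.isUnit_iff_isUnit_det _).1 hx),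
      Matrix.vecMul_one]
  conv_rhs => rw [h1]
  generalize x' ᵥ* (KM N x)⁻¹ = c
  rw [PM, Matrix.vecMul_sum]
  simp only [Matrix.vecMul_smul]
  rw [Matrix.vecMul_eq_sum]
  rfl

lemma comm_PM {N A : Matrix (Fin n) (Fin n) E} {x : Fin n → E} (hx : IsUnit (KM N x))
    (e : N * A = A * N) : ∃ c, A = PM N c := by
  obtain ⟨c, hc⟩ := exists_PM hx (x ᵥ* A)
  exact ⟨c, uniq hx e (PM_semi rfl c).symm hc.symm⟩

lemma comm_comm {N A A' : Matrix (Fin n) (Fin n) E} {x : Fin n → E} (hx : IsUnit (KM N x))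
    (e : N * A = A * N) (e' : N * A' = A' * N) : A * A' = A' * A := by
  obtain ⟨c, rfl⟩ := comm_PM hx e
  exact PM_semi e' c

/-- Inverse-free conjugacy of triples. -/
def TC (h N : Matrix (Fin n) (Fin n) E) (x y : Fin n → E)
    (N' : Matrix (Fin n) (Fin n) E) (x' y' : Fin n → E) : Prop :=
  IsUnit h ∧ N * h = h * N' ∧ x ᵥ* h = x' ∧ y = h *ᵥ y'

lemma inv_mul_of {h : Matrix (Fin n) (Fin n) E} (hh : IsUnit h) : h⁻¹ * h = 1 :=
  Matrix.nonsing_inv_mul _ ((Matrix.isUnit_iff_isUnit_det _).1 hh)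

lemma mul_inv_of {h : Matrix (Fin n) (Fin n) E} (hh : IsUnit h) : h * h⁻¹ = 1 :=
  Matrix.mul_nonsing_inv _ ((Matrix.isUnit_iff_isUnit_det _).1 hh)

lemma isUnit_inv_of {h : Matrix (Fin n) (Fin n) E} (hh : IsUnit h) : IsUnit h⁻¹ :=
  IsUnit.of_mul_eq_one _ (inv_mul_of hh)

lemma inv_mul_eq {h A C : Matrix (Fin n) (Fin n) E} (hh : IsUnit h) :
    h⁻¹ * A = C ↔ A = h * C := by
  constructor
  · rintro rfl; rw [← mul_assoc, mul_inv_of hh, one_mul]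
  · rintro rfl; rw [← mul_assoc, inv_mul_of hh, one_mul]

lemma inv_mulVec_eq {h : Matrix (Fin n) (Fin n) E} {v w : Fin n → E} (hh : IsUnit h) :
    h⁻¹ *ᵥ v = w ↔ v = h *ᵥ w := by
  constructor
  · rintro rfl; rw [Matrix.mulVec_mulVec, mul_inv_of hh, Matrix.one_mulVec]
  · rintro rfl; rw [Matrix.mulVec_mulVec, inv_mul_of hh, Matrix.one_mulVec]

lemma TC_iff (h N : Matrix (Fin n) (Fin n) E) (x y : Fin n → E)
    (N' : Matrix (Fin n) (Fin n) E) (x' y' : Fin n → E) :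
    TC h N x y N' x' y' ↔ IsUnit h ∧ h⁻¹ * N * h = N' ∧ x ᵥ* h = x' ∧ h⁻¹ *ᵥ y = y' := by
  unfold TC
  refine and_congr_right fun hh => ?_
  rw [mul_assoc, inv_mul_eq hh, inv_mulVec_eq hh]

lemma TC.symm {h N : Matrix (Fin n) (Fin n) E} {x y : Fin n → E}
    {N' : Matrix (Fin n) (Fin n) E} {x' y' : Fin n → E} (H : TC h N x y N' x' y') :
    TC h⁻¹ N' x' y' N x y := by
  obtain ⟨hh, e, rfl, rfl⟩ := H
  refine ⟨isUnit_inv_of hh, ?_, ?_, ?_⟩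
  · symm
    rw [inv_mul_eq hh, ← mul_assoc, ← e, mul_assoc, mul_inv_of hh, mul_one]
  · rw [Matrix.vecMul_vecMul, mul_inv_of hh, Matrix.vecMul_one]
  · rw [Matrix.mulVec_mulVec, inv_mul_of hh, Matrix.one_mulVec]

lemma TC.trans {h N : Matrix (Fin n) (Fin n) E} {x y : Fin n → E}
    {h' N' : Matrix (Fin n) (Fin n) E} {x' y' : Fin n → E}
    {N'' : Matrix (Fin n) (Fin n) E} {x'' y'' : Fin n → E}
    (H : TC h N x y N' x' y') (H' : TC h' N' x' y' N'' x'' y'') :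
    TC (h * h') N x y N'' x'' y'' := by
  obtain ⟨hh, e, rfl, rfl⟩ := H
  obtain ⟨hh', e', rfl, rfl⟩ := H'
  refine ⟨hh.mul hh', ?_, ?_, ?_⟩
  · rw [← mul_assoc, e, mul_assoc, e', mul_assoc]
  · rw [Matrix.vecMul_vecMul]
  · rw [Matrix.mulVec_mulVec]

lemma rss_conj {h N N' : Matrix (Fin n) (Fin n) E} (hh : IsUnit h) (e : N * h = h * N')
    (H : IsRegSemisimple N) : IsRegSemisimple N' := by
  have h1 : N' = h⁻¹ * N * h := by
    symm; rw [mul_assoc, inv_mul_eq hh, e]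
  have : N'.charpoly = N.charpoly := by
    obtain ⟨u, rfl⟩ := hh
    rw [h1, Matrix.charpoly_units_conj']
  unfold IsRegSemisimple
  rw [this]; exact H

lemma TC.triple {h N : Matrix (Fin n) (Fin n) E} {x y : Fin n → E}
    {N' : Matrix (Fin n) (Fin n) E} {x' y' : Fin n → E} (H : TC h N x y N' x' y')
    (T : TripleRegSemisimple N x y) : TripleRegSemisimple N' x' y' := by
  rw [triple_iff] at *
  obtain ⟨hh, e, rfl, rfl⟩ := H
  obtain ⟨t1, t2, t3⟩ := T
  refine ⟨rss_conj hh e t1, ?_, ?_⟩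
  · rw [← KM_mul e]; exact t2.mul hh
  · have e2 : N'ᵀ * hᵀ = hᵀ * Nᵀ := by
      rw [← Matrix.transpose_mul, ← Matrix.transpose_mul, e]
    have := KM_mul e2 y'
    rw [Matrix.vecMul_transpose] at this
    rw [← this] at t3
    rw [Matrix.isUnit_iff_isUnit_det, Matrix.det_mul] at t3
    rw [Matrix.isUnit_iff_isUnit_det]
    exact isUnit_of_mul_isUnit_left t3


variable (σ : E ≃ₐ[F] E)

lemma s_mul (A C : Matrix (Fin n) (Fin n) E) :
    (A * C).map ⇑σ = A.map ⇑σ * C.map ⇑σ := Matrix.map_mul (f := (σ : E →+* E))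

lemma s_one : (1 : Matrix (Fin n) (Fin n) E).map ⇑σ = 1 :=
  Matrix.map_one _ (map_zero σ) (map_one σ)

lemma s_pow (A : Matrix (Fin n) (Fin n) E) (k : ℕ) :
    (A ^ k).map ⇑σ = (A.map ⇑σ) ^ k := by
  induction k with
  | zero => simp only [pow_zero, s_one]
  | succ k ih => rw [pow_succ, s_mul, ih, pow_succ]

lemma s_unit {A : Matrix (Fin n) (Fin n) E} (h : IsUnit A) : IsUnit (A.map ⇑σ) := by
  refine IsUnit.of_mul_eq_one (A⁻¹.map ⇑σ) ?_
  rw [← s_mul, mul_inv_of h, s_one]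

lemma s_vecMul (v : Fin n → E) (A : Matrix (Fin n) (Fin n) E) :
    (fun i => σ ((v ᵥ* A) i)) = (fun i => σ (v i)) ᵥ* A.map ⇑σ := by
  funext i; exact RingHom.map_vecMul (σ : E →+* E) A v i

lemma s_mulVec (v : Fin n → E) (A : Matrix (Fin n) (Fin n) E) :
    (fun i => σ ((A *ᵥ v) i)) = A.map ⇑σ *ᵥ (fun i => σ (v i)) := by
  funext i; exact RingHom.map_mulVec (σ : E →+* E) A v i

lemma s_KM (N : Matrix (Fin n) (Fin n) E) (x : Fin n → E) :
    (KM N x).map ⇑σ = KM (N.map ⇑σ) (fun i => σ (x i)) := by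
  funext k
  rw [KM_row, ← s_pow, ← s_vecMul]; rfl

/-- conjugate transpose -/
abbrev ct (A : Matrix (Fin n) (Fin n) E) : Matrix (Fin n) (Fin n) E := (A.map ⇑σ)ᵀ

lemma ct_mul (A C : Matrix (Fin n) (Fin n) E) : ct σ (A * C) = ct σ C * ct σ A := by
  unfold ct; rw [s_mul, Matrix.transpose_mul]

lemma ct_unit {A : Matrix (Fin n) (Fin n) E} (h : IsUnit A) : IsUnit (ct σ A) :=
  (Matrix.isUnit_transpose _).2 (s_unit σ h)

lemma nu_eq {β ζ ν : Matrix (Fin n) (Fin n) E} (hβ : IsUnit β) :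
    nuMat σ β ζ = ν ↔ ct σ ζ * β * ζ = β * ν := by
  unfold nuMat
  rw [mul_assoc, mul_assoc, inv_mul_eq hβ, ← mul_assoc]

lemma ct_ct (hσ2 : ∀ x : E, σ (σ x) = x) (A : Matrix (Fin n) (Fin n) E) :
    ct σ (ct σ A) = A := by
  ext i j; simp [ct, hσ2]

lemma ss (hσ2 : ∀ x : E, σ (σ x) = x) (A : Matrix (Fin n) (Fin n) E) :
    (A.map ⇑σ).map ⇑σ = A := by
  ext i j; simp [hσ2]

lemma nu_selfadj (hσ2 : ∀ x : E, σ (σ x) = x) {β ζ ν : Matrix (Fin n) (Fin n) E}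
    (hβ : ct σ β = -β)
    (h : ct σ ζ * β * ζ = β * ν) : ct σ ν * β = β * ν := by
  have h2 := congrArg (ct σ) h
  rw [ct_mul, ct_mul, ct_mul, hβ, ct_ct σ hσ2, ← mul_assoc, mul_neg, neg_mul, mul_neg, h] at h2
  exact (neg_injective h2).symm

lemma exists_eps [CharZero E] (hfix : ∀ x : E, σ x = x ↔ x ∈ Set.range (algebraMap F E))
    (hσ2 : ∀ x : E, σ (σ x) = x)
    (hdeg : Module.finrank F E = 2) : ∃ ε : E, ε ≠ 0 ∧ σ ε = -ε := by
  by_contra hcon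
  have h : ∀ x : E, x ∈ Set.range (algebraMap F E) := by
    intro x
    rw [← hfix]
    by_contra hx
    exact hcon ⟨σ x - x, sub_ne_zero.2 hx, by rw [map_sub, hσ2]; ring⟩
  have : Module.finrank F E = 1 := by
    refine finrank_eq_one (1 : E) one_ne_zero fun w => ?_
    obtain ⟨c, hc⟩ := h w
    exact ⟨c, by rw [← hc, Algebra.smul_def, mul_one]⟩
  omega

lemma key [CharZero E] (hfix : ∀ x : E, σ x = x ↔ x ∈ Set.range (algebraMap F E))
    (hσ2 : ∀ x : E, σ (σ x) = x)
    (hdeg : Module.finrank F E = 2) {A : Matrix (Fin n) (Fin n) E} (hA : IsUnit A)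
    (C : Matrix (Fin n) (Fin n) E) : ∃ a : E, IsUnit (a • A + σ a • C) := by
  obtain ⟨ε, hε, hσε⟩ := exists_eps σ hfix hσ2 hdeg
  let Q : Matrix (Fin n) (Fin n) (Polynomial E) :=
    (Polynomial.X : Polynomial E) • (A + C).map Polynomial.C + (ε • (A - C)).map Polynomial.C
  have hev : ∀ k : E, Q.det.eval k = (k • (A + C) + ε • (A - C)).det := by
    intro k
    rw [← Polynomial.coe_evalRingHom, RingHom.map_det]
    congr 1
    ext i j
    simp [Q]
    try ring
  have hne : Q.det ≠ 0 := by
    intro h0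
    have h1 := hev ε
    rw [h0, Polynomial.eval_zero, ← smul_add] at h1
    have h2 : A + C + (A - C) = (2 : E) • A := by rw [two_smul]; abel
    rw [h2, smul_smul, Matrix.det_smul] at h1
    have h3 : A.det ≠ 0 := ((Matrix.isUnit_iff_isUnit_det _).1 hA).ne_zero
    have : (ε * 2) ^ Fintype.card (Fin n) ≠ 0 := pow_ne_zero _ (mul_ne_zero hε two_ne_zero)
    exact mul_ne_zero this h3 h1.symm
  have hex : ∃ k : ℕ, Q.det.eval (k : E) ≠ 0 := by
    by_contra hcon
    push Not at hcon
    apply hne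
    refine Polynomial.eq_zero_of_infinite_isRoot _ ?_
    refine (Set.infinite_range_of_injective (Nat.cast_injective (R := E))).mono ?_
    rintro _ ⟨k, rfl⟩
    exact hcon k
  obtain ⟨k, hk⟩ := hex
  refine ⟨k + ε, ?_⟩
  rw [Matrix.isUnit_iff_isUnit_det, isUnit_iff_ne_zero]
  rw [hev] at hk
  convert hk using 2
  rw [map_add, map_natCast, hσε]
  module

lemma match_iff (t : Matrix (Fin n) (Fin n) E × (Fin n → E) × (Fin n → E))
    (q : Matrix (Fin n) (Fin n) E × Matrix (Fin n) (Fin n) E × (Fin n → E)) :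
    MatchXY σ t q ↔ ∃ h, TC h ((t.1.map ⇑σ) * t.1) t.2.1 t.2.2 (nuMat σ q.1 q.2.1) q.2.2
      (q.1⁻¹ *ᵥ fun i => σ (q.2.2 i)) := by
  unfold MatchXY
  simp only [TC_iff]

end Helpers

section Parts

variable {F E : Type*} [Field F] [Field E] [Algebra F E] {n : ℕ} (σ : E ≃ₐ[F] E)

/-- elementary: norm is σ-fixed implies γ commutes with the norm -/
lemma gamma_comm {γ : Matrix (Fin n) (Fin n) E} (hσ2 : ∀ x : E, σ (σ x) = x)
    (hN : (γ.map ⇑σ * γ).map ⇑σ = γ.map ⇑σ * γ) :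
    γ * γ.map ⇑σ = γ.map ⇑σ * γ ∧ (γ.map ⇑σ * γ) * γ = γ * (γ.map ⇑σ * γ) := by
  have h1 : γ * γ.map ⇑σ = γ.map ⇑σ * γ := by
    rw [s_mul, ss σ hσ2] at hN; exact hN
  refine ⟨h1, ?_⟩
  conv_lhs => rw [← h1]
  rw [mul_assoc]

lemma fixed_of_range (hfix : ∀ x : E, σ x = x ↔ x ∈ Set.range (algebraMap F E))
    {A : Matrix (Fin n) (Fin n) E} (h : ∀ i j, A i j ∈ Set.range (algebraMap F E)) :
    A.map ⇑σ = A := by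
  ext i j; exact (hfix _).2 (h i j)

/-- elements of `T_γ` commute with the norm -/
lemma T_comm {γ g : Matrix (Fin n) (Fin n) E} (hσ2 : ∀ x : E, σ (σ x) = x)
    (hN : (γ.map ⇑σ * γ).map ⇑σ = γ.map ⇑σ * γ) (hg : IsUnit g)
    (h : g⁻¹ * γ * g.map ⇑σ = γ) : (γ.map ⇑σ * γ) * g = g * (γ.map ⇑σ * γ) := by
  rw [mul_assoc, inv_mul_eq hg] at h
  have h2 := congrArg (fun A => A.map ⇑σ) h
  simp only [s_mul, ss σ hσ2] at h2
  have h1 := (gamma_comm σ hσ2 hN).1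
  rw [← h1, mul_assoc, h2, ← mul_assoc, h, mul_assoc]

lemma U_comm {β ζ u ν : Matrix (Fin n) (Fin n) E} (hβ : IsUnit β)
    (hu : InUnitary σ β u) (h : u * ζ = ζ * u) (hν : ct σ ζ * β * ζ = β * ν) :
    ν * u = u * ν := by
  obtain ⟨u1, u2⟩ := hu
  have hc : IsUnit (ct σ u * β) := (ct_unit σ u1).mul hβ
  apply hc.mul_left_cancel
  have e1 : ct σ u * β * (u * ν) = β * ν := by rw [← mul_assoc, u2]
  rw [e1, ← hν]
  calc ct σ u * β * (ν * u) = ct σ u * (β * ν) * u := by simp only [mul_assoc]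
    _ = (ct σ u * ct σ ζ) * β * (ζ * u) := by rw [← hν]; simp only [mul_assoc]
    _ = ct σ ζ * (ct σ u * β * u) * ζ := by
      rw [← ct_mul, ← h, ← h.symm, ← h, ct_mul]; simp only [mul_assoc]
    _ = _ := by rw [u2]

lemma s_vec_unit {β u : Matrix (Fin n) (Fin n) E} (hβ : IsUnit β) (z : Fin n → E)
    (hu : InUnitary σ β u) :
    (β⁻¹ *ᵥ fun i => σ (z i)) = u *ᵥ (β⁻¹ *ᵥ fun i => σ ((z ᵥ* u) i)) := by
  obtain ⟨u1, u2⟩ := hu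
  rw [← inv_mulVec_eq u1, eq_comm, inv_mulVec_eq hβ, s_vecMul]
  rw [← Matrix.mulVec_transpose]
  set w := u⁻¹ *ᵥ β⁻¹ *ᵥ fun i => σ (z i) with hw
  have h1 := (inv_mulVec_eq u1).1 hw.symm
  have h2 := (inv_mulVec_eq hβ).1 h1
  rw [h2, Matrix.mulVec_mulVec, Matrix.mulVec_mulVec, u2]

/-- X-side injectivity core. -/
lemma inj_X [CharZero E] (hfix : ∀ x : E, σ x = x ↔ x ∈ Set.range (algebraMap F E))
    (hσ2 : ∀ x : E, σ (σ x) = x) (hdeg : Module.finrank F E = 2)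
    (S : Set (Matrix (Fin n) (Fin n) E))
    (hS1 : ∀ γ ∈ S, IsUnit γ ∧
      (∀ i j, ((γ.map ⇑σ) * γ) i j ∈ Set.range (algebraMap F E)) ∧
      IsRegSemisimple ((γ.map ⇑σ) * γ))
    (hS2 : ∀ δ : Matrix (Fin n) (Fin n) E, IsUnit δ → IsRegSemisimple ((δ.map ⇑σ) * δ) →
      ∃! γ, γ ∈ S ∧ ∃ g : Matrix (Fin n) (Fin n) E, IsUnit g ∧ g⁻¹ * δ * g.map ⇑σ = γ)
    (t t' : Matrix (Fin n) (Fin n) E × (Fin n → E) × (Fin n → E))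
    (ht : XrssElt σ S t) (ht' : XrssElt σ S t') (h : Matrix (Fin n) (Fin n) E)
    (H : TC h ((t.1.map ⇑σ) * t.1) t.2.1 t.2.2 ((t'.1.map ⇑σ) * t'.1) t'.2.1 t'.2.2) :
    XEquiv σ t t' := by
  obtain ⟨γ, x, y⟩ := t
  obtain ⟨γ', x', y'⟩ := t'
  obtain ⟨a1, a2, a3, a4⟩ := ht
  obtain ⟨b1, b2, b3, b4⟩ := ht'
  obtain ⟨hh, e1, e2, e3⟩ := H
  dsimp only at *
  obtain ⟨c1, c2, c3⟩ := hS1 γ a1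
  obtain ⟨d1, d2, d3⟩ := hS1 γ' b1
  have hN := fixed_of_range σ hfix c2
  have hN' := fixed_of_range σ hfix d2
  obtain ⟨g1, g2⟩ := gamma_comm σ hσ2 hN
  obtain ⟨g1', g2'⟩ := gamma_comm σ hσ2 hN'
  rw [triple_iff] at a4
  have fx : (fun i => σ (x i)) = x := funext fun i => (hfix _).2 (a2 i)
  have fx' : (fun i => σ (x' i)) = x' := funext fun i => (hfix _).2 (b2 i)
  have sh : h.map ⇑σ = h := by
    refine uniq (N' := γ'.map ⇑σ * γ') a4.2.1 ?_ e1 ?_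
    · have := congrArg (fun A => A.map ⇑σ) e1
      simp only [s_mul σ _ h, s_mul σ h _, hN, hN'] at this
      exact this
    · have := s_vecMul σ x h
      rw [e2, fx, fx'] at this
      rw [e2, ← this]
  have hγγ : γ = γ' := by
    obtain ⟨δ, hδ⟩ : ∃ δ, δ * h = h * γ' :=
      ⟨h * γ' * h⁻¹, by rw [mul_assoc, inv_mul_of hh, mul_one]⟩
    have nδ : δ.map ⇑σ * δ = γ.map ⇑σ * γ := by
      apply hh.mul_right_cancel
      have := congrArg (fun A => A.map ⇑σ) hδ
      simp only [s_mul, sh] at this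
      rw [e1, mul_assoc, hδ, ← mul_assoc, this, mul_assoc]
    have uδ : IsUnit δ := by
      have : δ = h * γ' * h⁻¹ := by
        rw [← hδ, mul_assoc, mul_inv_of hh, mul_one]
      rw [this]; exact (hh.mul d1).mul (isUnit_inv_of hh)
    obtain ⟨a, ha⟩ := key σ hfix hσ2 hdeg (s_unit σ uδ) γ
    set d := a • δ.map ⇑σ + σ a • γ with hd
    have sd : d.map ⇑σ = σ a • δ + a • γ.map ⇑σ := by
      ext i j; simp [hd, hσ2]
    have hconj : γ * d.map ⇑σ = d * δ := by
      rw [sd, hd, mul_add, add_mul, mul_smul_comm, mul_smul_comm, smul_mul_assoc, smul_mul_assoc,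
        nδ, g1, add_comm]
    refine (hS2 γ c1 c3).unique ⟨a1, 1, isUnit_one, ?_⟩ ⟨b1, d * h, ha.mul hh, ?_⟩
    · rw [s_one]; simp
    · rw [mul_assoc, inv_mul_eq (ha.mul hh), s_mul, sh, ← mul_assoc, hconj, mul_assoc, hδ,
        mul_assoc]
  subst hγγ
  refine ⟨rfl, h, hh, ?_, e2, ?_⟩
  · rw [mul_assoc, inv_mul_eq hh, sh]
    exact comm_comm a4.2.1 g2 e1
  · rw [inv_mulVec_eq hh]; exact e3

/-- Y-side injectivity core. -/
lemma inj_Y (hσ2 : ∀ x : E, σ (σ x) = x)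
    (B : Set (Matrix (Fin n) (Fin n) E))
    (hB1 : ∀ β ∈ B, IsUnit β ∧ (β.map ⇑σ)ᵀ = -β)
    (hB2 : ∀ β' : Matrix (Fin n) (Fin n) E, IsUnit β' → (β'.map ⇑σ)ᵀ = -β' →
      ∃! β, β ∈ B ∧ ∃ a : Matrix (Fin n) (Fin n) E, IsUnit a ∧ β' = (a.map ⇑σ)ᵀ * β * a)
    (R : Matrix (Fin n) (Fin n) E → Set (Matrix (Fin n) (Fin n) E))
    (hR1 : ∀ β ∈ B, ∀ ζ ∈ R β, IsUnit ζ ∧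
      ζ * nuMat σ β ζ = nuMat σ β ζ * ζ ∧
      IsRegSemisimple (nuMat σ β ζ) ∧
      ∃ γ₀ : Matrix (Fin n) (Fin n) E, IsUnit γ₀ ∧ nuMat σ β ζ = (γ₀.map ⇑σ) * γ₀)
    (hR2 : ∀ β ∈ B, ∀ ζ' : Matrix (Fin n) (Fin n) E, IsUnit ζ' →
      IsRegSemisimple (nuMat σ β ζ') →
      (∃ γ₀ : Matrix (Fin n) (Fin n) E, IsUnit γ₀ ∧ nuMat σ β ζ' = (γ₀.map ⇑σ) * γ₀) →
      ∃! ζ, ζ ∈ R β ∧ ∃ g, InUnitary σ β g ∧ ∃ h, InUnitary σ β h ∧ g⁻¹ * ζ' * h = ζ)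
    (q q' : Matrix (Fin n) (Fin n) E × Matrix (Fin n) (Fin n) E × (Fin n → E))
    (hq : YrssElt σ B R q) (hq' : YrssElt σ B R q') (h : Matrix (Fin n) (Fin n) E)
    (H : TC h (nuMat σ q.1 q.2.1) q.2.2 (q.1⁻¹ *ᵥ fun i => σ (q.2.2 i))
      (nuMat σ q'.1 q'.2.1) q'.2.2 (q'.1⁻¹ *ᵥ fun i => σ (q'.2.2 i))) :
    YEquiv σ q q' := by
  obtain ⟨β, ζ, z⟩ := q
  obtain ⟨β', ζ', z'⟩ := q'
  obtain ⟨a1, a2, a3⟩ := hq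
  obtain ⟨b1, b2, b3⟩ := hq'
  obtain ⟨hh, e1, e2, e3⟩ := H
  dsimp only at *
  obtain ⟨uβ, sβ⟩ := hB1 β a1
  obtain ⟨uβ', sβ'⟩ := hB1 β' b1
  obtain ⟨uζ, cζ, rζ, γ₀, uγ₀, nγ₀⟩ := hR1 β a1 ζ a2
  obtain ⟨uζ', cζ', rζ', -⟩ := hR1 β' b1 ζ' b2
  rw [triple_iff] at a3 b3
  have hν := (nu_eq σ (ζ := ζ) uβ).1 rfl
  have hν' := (nu_eq σ (ζ := ζ') uβ').1 rfl
  set ν := nuMat σ β ζ with hνdef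
  set ν' := nuMat σ β' ζ' with hνdef'
  have sa := nu_selfadj σ hσ2 sβ hν
  have sa' := nu_selfadj σ hσ2 sβ' hν'
  obtain ⟨w, hw⟩ : ∃ w, w = β⁻¹ *ᵥ fun i => σ (z i) := ⟨_, rfl⟩
  obtain ⟨w', hw'⟩ : ∃ w', w' = β'⁻¹ *ᵥ fun i => σ (z' i) := ⟨_, rfl⟩
  rw [← hw, ← hw'] at e3
  rw [← hw] at a3
  rw [← hw'] at b3
  have w1 := (inv_mulVec_eq uβ).1 hw.symm
  have w1' := (inv_mulVec_eq uβ').1 hw'.symm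
  have hβ : ct σ h * β * h = β' := by
    apply Matrix.transpose_injective
    refine uniq (N' := (ct σ ν')ᵀ) b3.2.2 ?_ ?_ ?_
    · rw [← Matrix.transpose_mul, ← Matrix.transpose_mul]
      congr 1
      calc ct σ h * β * h * ν' = ct σ h * (β * ν) * h := by
            rw [mul_assoc _ h, ← e1]; simp only [mul_assoc]
        _ = ct σ (ν * h) * β * h := by rw [← sa, ct_mul]; simp only [mul_assoc]
        _ = _ := by rw [e1, ct_mul]; simp only [mul_assoc]
    · rw [← Matrix.transpose_mul, ← Matrix.transpose_mul, sa']
    · rw [Matrix.vecMul_transpose, Matrix.vecMul_transpose, ← w1', ← e2, s_vecMul, w1, e3,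
        ← Matrix.mulVec_transpose]
      simp only [Matrix.mulVec_mulVec, mul_assoc]
  have hββ : β = β' := by
    refine (hB2 β' uβ' sβ').unique ⟨a1, h, hh, hβ.symm⟩ ⟨b1, 1, isUnit_one, ?_⟩
    rw [s_one]; simp
  subst hββ
  have hU : InUnitary σ β h := ⟨hh, hβ⟩
  have hζζ : ζ = ζ' := by
    obtain ⟨g, hg⟩ : ∃ g, g * ζ' = ζ * h :=
      ⟨ζ * h * ζ'⁻¹, by rw [mul_assoc, inv_mul_of uζ', mul_one]⟩
    have ug : IsUnit g := by
      have : g = ζ * h * ζ'⁻¹ := by rw [← hg, mul_assoc, mul_inv_of uζ', mul_one]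
      rw [this]; exact (uζ.mul hh).mul (isUnit_inv_of uζ')
    have Ug : InUnitary σ β g := by
      refine ⟨ug, ?_⟩
      apply uζ'.mul_right_cancel
      apply (ct_unit σ uζ').mul_left_cancel
      calc ct σ ζ' * (ct σ g * β * g * ζ') = ct σ (g * ζ') * β * (g * ζ') := by
            rw [ct_mul]; simp only [mul_assoc]
        _ = ct σ h * (ct σ ζ * β * ζ) * h := by rw [hg, ct_mul]; simp only [mul_assoc]
        _ = ct σ h * β * (ν * h) := by rw [hν]; simp only [mul_assoc]
        _ = β * ν' := by rw [e1, ← mul_assoc, hβ]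
        _ = _ := by rw [← hν']; simp only [mul_assoc]
    refine (hR2 β a1 ζ uζ rζ ⟨γ₀, uγ₀, nγ₀⟩).unique ⟨a2, 1, ?_, 1, ?_, ?_⟩
      ⟨b2, g, Ug, h, hU, ?_⟩
    · exact ⟨isUnit_one, by rw [s_one]; simp⟩
    · exact ⟨isUnit_one, by rw [s_one]; simp⟩
    · simp
    · rw [mul_assoc, inv_mul_eq ug, hg]
  subst hζζ
  exact ⟨rfl, rfl, h, hU, comm_comm a3.2.1 e1 cζ.symm, e2⟩

end Parts

section Parts2

variable {F E : Type*} [Field F] [Field E] [Algebra F E] {n : ℕ} (σ : E ≃ₐ[F] E)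

lemma KM_pairing (N : Matrix (Fin n) (Fin n) E) (x y : Fin n → E)
    (M : Matrix (Fin n) (Fin n) E) (i j : Fin n) :
    (KM N x * M * (KM Nᵀ y)ᵀ) i j = x ⬝ᵥ ((N ^ (i : ℕ) * M * N ^ (j : ℕ)) *ᵥ y) := by
  have : (KM N x * M * (KM Nᵀ y)ᵀ) i j = ((KM N x * M) i) ⬝ᵥ ((KM Nᵀ y) j) := rfl
  rw [this, Matrix.mul_apply_eq_vecMul, KM_row, KM_row, ← Matrix.transpose_pow,
    Matrix.vecMul_transpose, Matrix.vecMul_vecMul, ← Matrix.dotProduct_mulVec,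
    Matrix.mulVec_mulVec]

/-- the skew-Hermitian form attached to an `F`-rational triple -/
lemma exists_form (hn : 1 ≤ n) {N : Matrix (Fin n) (Fin n) E} {x y : Fin n → E}
    (hN : N.map ⇑σ = N) (hx : (fun i => σ (x i)) = x) (hy : (fun i => σ (y i)) = -y)
    (ux : IsUnit (KM N x)) (uy : IsUnit (KM Nᵀ y)) :
    ∃ β : Matrix (Fin n) (Fin n) E, IsUnit β ∧ ct σ β = -β ∧ Nᵀ * β = β * N ∧ β *ᵥ y = x := by
  have sK : (KM N x).map ⇑σ = KM N x := by rw [s_KM, hN, hx]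
  have sP : (KM Nᵀ y).map ⇑σ = - KM Nᵀ y := by
    rw [s_KM, hy, Matrix.transpose_map, hN]
    funext k
    rw [KM_row, Matrix.neg_vecMul]; rfl
  have sym1 : KM Nᵀ y * (KM N x)ᵀ = KM N x * (KM Nᵀ y)ᵀ := by
    have : KM Nᵀ y * (KM N x)ᵀ = (KM N x * (KM Nᵀ y)ᵀ)ᵀ := by
      rw [Matrix.transpose_mul, Matrix.transpose_transpose]
    rw [this]
    ext i j
    rw [Matrix.transpose_apply]
    have e1 := KM_pairing N x y 1 j i
    have e2 := KM_pairing N x y 1 i j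
    simp only [mul_one] at e1 e2
    rw [e1, e2, ← pow_add, ← pow_add, add_comm]
  have sym2 : KM Nᵀ y * Nᵀ * (KM N x)ᵀ = KM N x * N * (KM Nᵀ y)ᵀ := by
    have : KM Nᵀ y * Nᵀ * (KM N x)ᵀ = (KM N x * N * (KM Nᵀ y)ᵀ)ᵀ := by
      rw [Matrix.transpose_mul, Matrix.transpose_mul, Matrix.transpose_transpose, mul_assoc]
    rw [this]
    ext i j
    rw [Matrix.transpose_apply, KM_pairing, KM_pairing, ← pow_succ, ← pow_succ, ← pow_add,
      ← pow_add]
    congr 3; omega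
  have row0 : (KM Nᵀ y) ⟨0, hn⟩ = y := by rw [KM_row]; simp
  have row0' : (KM N x) ⟨0, hn⟩ = x := by rw [KM_row]; simp
  generalize KM N x = K at *
  generalize KM Nᵀ y = P at *
  have uPt : IsUnit Pᵀ := (Matrix.isUnit_transpose _).2 uy
  have uKt : IsUnit Kᵀ := (Matrix.isUnit_transpose _).2 ux
  obtain ⟨β, hβ⟩ : ∃ β, β * Pᵀ = Kᵀ :=
    ⟨Kᵀ * (Pᵀ)⁻¹, by rw [mul_assoc, inv_mul_of uPt, mul_one]⟩
  have uβ : IsUnit β := by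
    have : β = Kᵀ * (Pᵀ)⁻¹ := by rw [← hβ, mul_assoc, mul_inv_of uPt, mul_one]
    rw [this]; exact uKt.mul (isUnit_inv_of uPt)
  have hβ' : P * βᵀ = K := by
    rw [← Matrix.transpose_transpose P, ← Matrix.transpose_mul, hβ, Matrix.transpose_transpose]
  have βsym : βᵀ = β := by
    apply uPt.mul_right_cancel
    apply uy.mul_left_cancel
    rw [hβ, sym1, ← mul_assoc, hβ']
  rw [βsym] at hβ'
  refine ⟨β, uβ, ?_, ?_, ?_⟩
  · have := congrArg (fun A => A.map ⇑σ) hβ'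
    simp only [s_mul, sP, sK] at this
    have h3 : β.map ⇑σ = -β := by
      apply uy.mul_left_cancel
      rw [mul_neg, hβ', ← this, neg_mul, neg_neg]
    unfold ct
    rw [h3, Matrix.transpose_neg, βsym]
  · apply uPt.mul_right_cancel
    apply uy.mul_left_cancel
    calc P * (Nᵀ * β * Pᵀ) = P * Nᵀ * (β * Pᵀ) := by simp only [mul_assoc]
      _ = K * N * Pᵀ := by rw [hβ, sym2]
      _ = _ := by rw [← hβ']; simp only [mul_assoc]
  · have := congrFun hβ' ⟨0, hn⟩
    rw [Matrix.mul_apply_eq_vecMul, row0, row0', ← Matrix.mulVec_transpose, βsym] at this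
    exact this

lemma total (hfix : ∀ x : E, σ x = x ↔ x ∈ Set.range (algebraMap F E))
    (hσ2 : ∀ x : E, σ (σ x) = x) (hn : 1 ≤ n)
    (S : Set (Matrix (Fin n) (Fin n) E))
    (hS1 : ∀ γ ∈ S, IsUnit γ ∧
      (∀ i j, ((γ.map ⇑σ) * γ) i j ∈ Set.range (algebraMap F E)) ∧
      IsRegSemisimple ((γ.map ⇑σ) * γ))
    (B : Set (Matrix (Fin n) (Fin n) E))
    (hB1 : ∀ β ∈ B, IsUnit β ∧ (β.map ⇑σ)ᵀ = -β)
    (hB2 : ∀ β' : Matrix (Fin n) (Fin n) E, IsUnit β' → (β'.map ⇑σ)ᵀ = -β' →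
      ∃! β, β ∈ B ∧ ∃ a : Matrix (Fin n) (Fin n) E, IsUnit a ∧ β' = (a.map ⇑σ)ᵀ * β * a)
    (R : Matrix (Fin n) (Fin n) E → Set (Matrix (Fin n) (Fin n) E))
    (hR2 : ∀ β ∈ B, ∀ ζ' : Matrix (Fin n) (Fin n) E, IsUnit ζ' →
      IsRegSemisimple (nuMat σ β ζ') →
      (∃ γ₀ : Matrix (Fin n) (Fin n) E, IsUnit γ₀ ∧ nuMat σ β ζ' = (γ₀.map ⇑σ) * γ₀) →
      ∃! ζ, ζ ∈ R β ∧ ∃ g, InUnitary σ β g ∧ ∃ h, InUnitary σ β h ∧ g⁻¹ * ζ' * h = ζ)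
    (t : Matrix (Fin n) (Fin n) E × (Fin n → E) × (Fin n → E)) (ht : XrssElt σ S t) :
    ∃ q, YrssElt σ B R q ∧ MatchXY σ t q := by
  obtain ⟨γ, x, y⟩ := t
  obtain ⟨a1, a2, a3, a4⟩ := ht
  dsimp only at *
  obtain ⟨c1, c2, c3⟩ := hS1 γ a1
  have hN := fixed_of_range σ hfix c2
  obtain ⟨g1, g2⟩ := gamma_comm σ hσ2 hN
  have fx : (fun i => σ (x i)) = x := funext fun i => (hfix _).2 (a2 i)
  have fy : (fun i => σ (y i)) = -y := funext fun i => a3 i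
  have T := a4
  rw [triple_iff] at a4
  obtain ⟨βt, ub, sb, cb, yb⟩ := exists_form σ hn hN fx fy a4.2.1 a4.2.2
  obtain ⟨β, ⟨hβB, a, ua, ha⟩, -⟩ := hB2 βt ub sb
  obtain ⟨uβ, sβ⟩ := hB1 β hβB
  have hγ : ct σ γ * βt = βt * γ.map ⇑σ := by
    have hcomm : (γ.map ⇑σ * γ) * γ.map ⇑σ = γ.map ⇑σ * (γ.map ⇑σ * γ) := by
      rw [mul_assoc, g1]
    obtain ⟨c, hc⟩ := comm_PM a4.2.1 hcomm
    unfold ct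
    have h2 := PM_semi cb c
    rw [← hc] at h2
    rw [← h2]
    congr 1
    conv_lhs => rw [hc]
    simp [PM, Matrix.transpose_sum]
  obtain ⟨ζ', hζ'⟩ : ∃ ζ', ζ' * a = a * γ :=
    ⟨a * γ * a⁻¹, by rw [mul_assoc, inv_mul_of ua, mul_one]⟩
  have uζ' : IsUnit ζ' := by
    have : ζ' = a * γ * a⁻¹ := by rw [← hζ', mul_assoc, mul_inv_of ua, mul_one]
    rw [this]; exact (ua.mul c1).mul (isUnit_inv_of ua)
  have hν' := (nu_eq σ (ζ := ζ') uβ).1 rfl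
  set ν' := nuMat σ β ζ' with hν'def
  have cν' : ν' * a = a * (γ.map ⇑σ * γ) := by
    apply ((ct_unit σ ua).mul uβ).mul_left_cancel
    calc ct σ a * β * (ν' * a) = ct σ a * (β * ν') * a := by simp only [mul_assoc]
      _ = ct σ (ζ' * a) * β * (ζ' * a) := by rw [← hν', ct_mul]; simp only [mul_assoc]
      _ = ct σ γ * (ct σ a * β * a) * γ := by rw [hζ', ct_mul]; simp only [mul_assoc]
      _ = ct σ a * β * a * (γ.map ⇑σ * γ) := by rw [← ha, hγ, mul_assoc]
      _ = _ := by simp only [mul_assoc]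
  have rν' : IsRegSemisimple ν' := by
    refine rss_conj (isUnit_inv_of ua) ?_ c3
    symm
    rw [inv_mul_eq ua, ← mul_assoc, ← cν', mul_assoc, mul_inv_of ua, mul_one]
  obtain ⟨ζ, ⟨hζR, g, hg, h, hh, hgh⟩, -⟩ := hR2 β hβB ζ' uζ' rν'
    ⟨a.map ⇑σ * γ * a⁻¹, ((s_unit σ ua).mul c1).mul (isUnit_inv_of ua), by
      apply ua.mul_right_cancel
      have i1 : (a⁻¹).map ⇑σ * a.map ⇑σ = 1 := by rw [← s_mul, inv_mul_of ua, s_one]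
      rw [cν', s_mul, s_mul, ss σ hσ2]
      have i2 := inv_mul_of ua
      generalize (a⁻¹).map ⇑σ = p at *
      generalize a⁻¹ = r at *
      calc a * (γ.map ⇑σ * γ) = a * γ.map ⇑σ * (p * a.map ⇑σ) * γ * (r * a) := by
            rw [i1, i2]; simp only [mul_assoc, mul_one]
        _ = _ := by simp only [mul_assoc]⟩
  rw [mul_assoc, inv_mul_eq hg.1] at hgh
  have hν := (nu_eq σ (ζ := ζ) uβ).1 rfl
  set ν := nuMat σ β ζ with hνdef
  have cν : ν' * h = h * ν := by
    apply ((ct_unit σ hh.1).mul uβ).mul_left_cancel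
    calc ct σ h * β * (ν' * h) = ct σ h * (β * ν') * h := by simp only [mul_assoc]
      _ = ct σ (ζ' * h) * β * (ζ' * h) := by rw [← hν', ct_mul]; simp only [mul_assoc]
      _ = ct σ ζ * (ct σ g * β * g) * ζ := by rw [hgh, ct_mul]; simp only [mul_assoc]
      _ = β * ν := by rw [← hν]; unfold ct; rw [hg.2]
      _ = ct σ h * β * h * ν := by unfold ct; rw [hh.2]
      _ = _ := by simp only [mul_assoc]
  obtain ⟨k, hk⟩ : ∃ k, a * k = h :=
    ⟨a⁻¹ * h, by rw [← mul_assoc, mul_inv_of ua, one_mul]⟩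
  have uk : IsUnit k := by
    have : k = a⁻¹ * h := by rw [← hk, ← mul_assoc, inv_mul_of ua, one_mul]
    rw [this]; exact (isUnit_inv_of ua).mul hh.1
  have TCk : TC k (γ.map ⇑σ * γ) x y ν (x ᵥ* k) (β⁻¹ *ᵥ fun i => σ ((x ᵥ* k) i)) := by
    refine ⟨uk, ?_, rfl, ?_⟩
    · apply ua.mul_left_cancel
      rw [← mul_assoc, ← cν', mul_assoc, hk, ← mul_assoc, hk, cν]
    · rw [← inv_mulVec_eq uk, eq_comm, inv_mulVec_eq uβ, s_vecMul, fx, ← Matrix.mulVec_transpose]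
      obtain ⟨w, hw⟩ : ∃ w, w = k⁻¹ *ᵥ y := ⟨_, rfl⟩
      have h1 := (inv_mulVec_eq uk).1 hw.symm
      have h2 : ct σ h * β * h = β := hh.2
      rw [← hw, ← yb, h1, ha]
      conv_rhs => rw [← h2, ← hk, ct_mul]
      simp only [Matrix.mulVec_mulVec, mul_assoc]
  refine ⟨(β, ζ, x ᵥ* k), ⟨hβB, hζR, TCk.triple T⟩, ?_⟩
  rw [match_iff]
  exact ⟨k, TCk⟩

lemma cototal [CharZero E] (hfix : ∀ x : E, σ x = x ↔ x ∈ Set.range (algebraMap F E))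
    (hσ2 : ∀ x : E, σ (σ x) = x) (hdeg : Module.finrank F E = 2)
    (S : Set (Matrix (Fin n) (Fin n) E))
    (hS1 : ∀ γ ∈ S, IsUnit γ ∧
      (∀ i j, ((γ.map ⇑σ) * γ) i j ∈ Set.range (algebraMap F E)) ∧
      IsRegSemisimple ((γ.map ⇑σ) * γ))
    (hS2 : ∀ δ : Matrix (Fin n) (Fin n) E, IsUnit δ → IsRegSemisimple ((δ.map ⇑σ) * δ) →
      ∃! γ, γ ∈ S ∧ ∃ g : Matrix (Fin n) (Fin n) E, IsUnit g ∧ g⁻¹ * δ * g.map ⇑σ = γ)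
    (B : Set (Matrix (Fin n) (Fin n) E))
    (hB1 : ∀ β ∈ B, IsUnit β ∧ (β.map ⇑σ)ᵀ = -β)
    (R : Matrix (Fin n) (Fin n) E → Set (Matrix (Fin n) (Fin n) E))
    (hR1 : ∀ β ∈ B, ∀ ζ ∈ R β, IsUnit ζ ∧
      ζ * nuMat σ β ζ = nuMat σ β ζ * ζ ∧
      IsRegSemisimple (nuMat σ β ζ) ∧
      ∃ γ₀ : Matrix (Fin n) (Fin n) E, IsUnit γ₀ ∧ nuMat σ β ζ = (γ₀.map ⇑σ) * γ₀)
    (q : Matrix (Fin n) (Fin n) E × Matrix (Fin n) (Fin n) E × (Fin n → E))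
    (hq : YrssElt σ B R q) :
    ∃ t, XrssElt σ S t ∧ MatchXY σ t q := by
  obtain ⟨β, ζ, z⟩ := q
  obtain ⟨a1, a2, a3⟩ := hq
  dsimp only at *
  obtain ⟨uβ, sβ⟩ := hB1 β a1
  obtain ⟨uζ, cζ, rζ, γ₀, uγ₀, nγ₀⟩ := hR1 β a1 ζ a2
  have hν := (nu_eq σ (ζ := ζ) uβ).1 rfl
  have T := a3
  have hgoal : ∃ t, XrssElt σ S t ∧ ∃ h, TC h ((t.1.map ⇑σ) * t.1) t.2.1 t.2.2 (nuMat σ β ζ) z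
      (β⁻¹ *ᵥ fun i => σ (z i)) := by
    set ν := nuMat σ β ζ with hνdef
    have sa := nu_selfadj σ hσ2 sβ hν
    obtain ⟨w, hw⟩ : ∃ w, w = β⁻¹ *ᵥ fun i => σ (z i) := ⟨_, rfl⟩
    have w1 := (inv_mulVec_eq uβ).1 hw.symm
    rw [← hw] at a3 T ⊢
    rw [triple_iff] at a3
    obtain ⟨γ, ⟨hγS, g, ug, hg⟩, -⟩ := hS2 γ₀ uγ₀ (nγ₀ ▸ rζ)
    rw [mul_assoc, inv_mul_eq ug] at hg
    obtain ⟨c1, c2, c3⟩ := hS1 γ hγS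
    have hN := fixed_of_range σ hfix c2
    have e0 : ν * g.map ⇑σ = g.map ⇑σ * (γ.map ⇑σ * γ) := by
      have := congrArg (fun A => A.map ⇑σ) hg
      simp only [s_mul, ss σ hσ2] at this
      rw [nγ₀, mul_assoc, hg, ← mul_assoc, this, mul_assoc]
    have uh0 := s_unit σ ug
    generalize g.map ⇑σ = h0 at e0 uh0
    set N := γ.map ⇑σ * γ with hNdef
    have ux0 : IsUnit (KM N (z ᵥ* h0)) := by
      rw [← KM_mul e0]; exact a3.2.1.mul uh0
    set x0 := z ᵥ* h0 with hx0
    obtain ⟨a, ha⟩ := key σ hfix hσ2 hdeg ux0 ((KM N x0).map ⇑σ)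
    set x1 : Fin n → E := a • x0 + σ a • (fun i => σ (x0 i)) with hx1
    have ux1 : IsUnit (KM N x1) := by
      convert ha using 1
      rw [s_KM, hN]
      funext k
      change x1 ᵥ* N ^ (k : ℕ) = a • (x0 ᵥ* N ^ (k : ℕ)) + σ a • ((fun i => σ (x0 i)) ᵥ* N ^ (k : ℕ))
      rw [hx1, Matrix.add_vecMul, Matrix.smul_vecMul, Matrix.smul_vecMul]
    have fx1 : ∀ i, σ (x1 i) = x1 i := by
      intro i
      simp only [hx1, Pi.add_apply, Pi.smul_apply, smul_eq_mul, map_add, map_mul, hσ2]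
      ring
    obtain ⟨c, hc⟩ := exists_PM ux0 x1
    have cc : N * PM N c = PM N c * N := (PM_semi rfl c).symm
    have uc : IsUnit (PM N c) := by
      have := KM_mul cc x0
      rw [hc] at this
      rw [← this] at ux1
      rw [Matrix.isUnit_iff_isUnit_det, Matrix.det_mul] at ux1
      rw [Matrix.isUnit_iff_isUnit_det]
      exact isUnit_of_mul_isUnit_right ux1
    have uh1 : IsUnit (h0 * PM N c) := uh0.mul uc
    have e1 : ν * (h0 * PM N c) = (h0 * PM N c) * N := by
      rw [← mul_assoc, e0, mul_assoc, cc, mul_assoc]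
    have zx : z ᵥ* (h0 * PM N c) = x1 := by
      rw [← Matrix.vecMul_vecMul, ← hx0, hc]
    generalize h0 * PM N c = h1 at uh1 e1 zx
    obtain ⟨y1, hy1⟩ : ∃ y1, w = h1 *ᵥ y1 :=
      ⟨h1⁻¹ *ᵥ w, (inv_mulVec_eq uh1).1 rfl⟩
    have TC1 : TC h1 ν z w N x1 y1 := ⟨uh1, e1, zx, hy1⟩
    have fy1 : (fun i => σ (y1 i)) = -y1 := by
      have fx : (fun i => σ (x1 i)) = x1 := funext fx1
      have hs : ∀ k : ℕ, (x1 ᵥ* N ^ k) ⬝ᵥ y1 = z ⬝ᵥ (ν ^ k *ᵥ w) := by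
        intro k
        rw [← zx, hy1, Matrix.mulVec_mulVec, semi_pow e1, Matrix.vecMul_vecMul,
          ← Matrix.dotProduct_mulVec]
      have hdot : ∀ u v : Fin n → E, σ (u ⬝ᵥ v) = (fun i => σ (u i)) ⬝ᵥ (fun i => σ (v i)) := by
        intro u v; simp [dotProduct]
      have zw : z = - ((fun i => σ (w i)) ᵥ* β) := by
        have h3 := s_mulVec σ w β
        rw [← w1] at h3
        simp only [hσ2] at h3
        have h4 : β.map ⇑σ = (-β)ᵀ := by rw [← sβ, Matrix.transpose_transpose]
        rw [h4, Matrix.mulVec_transpose, Matrix.vecMul_neg] at h3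
        exact h3
      have hskew : ∀ k : ℕ, σ (z ⬝ᵥ (ν ^ k *ᵥ w)) = - (z ⬝ᵥ (ν ^ k *ᵥ w)) := by
        intro k
        have sak : β * ν ^ k = (ct σ ν) ^ k * β := (semi_pow sa k).symm
        have r1 : z ⬝ᵥ (ν ^ k *ᵥ w)
            = - ((fun i => σ (w i)) ⬝ᵥ ((ct σ ν) ^ k *ᵥ (fun i => σ (z i)))) := by
          conv_lhs => rw [zw]
          rw [neg_dotProduct, ← Matrix.dotProduct_mulVec, Matrix.mulVec_mulVec, sak, w1,
            Matrix.mulVec_mulVec]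
        rw [r1, neg_neg, ← r1, hdot, s_mulVec, s_pow]
        unfold ct
        rw [← Matrix.transpose_pow, Matrix.mulVec_transpose, Matrix.dotProduct_mulVec,
          dotProduct_comm]
      have : KM N x1 *ᵥ (fun i => σ (y1 i)) = KM N x1 *ᵥ (-y1) := by
        funext k
        change (x1 ᵥ* N ^ (k : ℕ)) ⬝ᵥ (fun i => σ (y1 i)) = (x1 ᵥ* N ^ (k : ℕ)) ⬝ᵥ (-y1)
        have h5 : (fun i => σ ((x1 ᵥ* N ^ (k : ℕ)) i)) = x1 ᵥ* N ^ (k : ℕ) := by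
          rw [s_vecMul, s_pow, hN, fx]
        conv_lhs => rw [← h5]
        rw [← hdot, hs, hskew, ← hs, dotProduct_neg]
      exact Matrix.mulVec_injective_of_isUnit ux1 this
    exact ⟨(γ, x1, y1), ⟨hγS, fun i => (hfix _).1 (fx1 i), fun i => congrFun fy1 i,
      TC1.triple T⟩, h1⁻¹, TC1.symm⟩
  obtain ⟨t, h1, h2⟩ := hgoal
  exact ⟨t, h1, (match_iff σ t _).2 h2⟩

end Parts2

theorem global_orbit_matching_bijection
    {F E : Type*} [Field F] [Field E] [Algebra F E]
    [NumberField F] [NumberField E]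
    (σ : E ≃ₐ[F] E)
    (hσ2 : ∀ x : E, σ (σ x) = x)
    (hfix : ∀ x : E, σ x = x ↔ x ∈ Set.range (algebraMap F E))
    (hdeg : Module.finrank F E = 2)
    (n : ℕ) (hn : 1 ≤ n)
    -- S: a set of normal representatives of the regular semisimple σ-conjugacy
    -- classes of GL_n(E)
    (S : Set (Matrix (Fin n) (Fin n) E))
    (hS1 : ∀ γ ∈ S, IsUnit γ ∧
      (∀ i j, ((γ.map ⇑σ) * γ) i j ∈ Set.range (algebraMap F E)) ∧
      IsRegSemisimple ((γ.map ⇑σ) * γ))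
    (hS2 : ∀ δ : Matrix (Fin n) (Fin n) E, IsUnit δ → IsRegSemisimple ((δ.map ⇑σ) * δ) →
      ∃! γ, γ ∈ S ∧ ∃ g : Matrix (Fin n) (Fin n) E, IsUnit g ∧ g⁻¹ * δ * g.map ⇑σ = γ)
    -- B: a set of representatives of the similarity classes of skew-Hermitian
    -- matrices
    (B : Set (Matrix (Fin n) (Fin n) E))
    (hB1 : ∀ β ∈ B, IsUnit β ∧ (β.map ⇑σ)ᵀ = -β)
    (hB2 : ∀ β' : Matrix (Fin n) (Fin n) E, IsUnit β' → (β'.map ⇑σ)ᵀ = -β' →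
      ∃! β, β ∈ B ∧ ∃ a : Matrix (Fin n) (Fin n) E, IsUnit a ∧ β' = (a.map ⇑σ)ᵀ * β * a)
    -- R β: for each β ∈ B, a set of normal representatives of the regular
    -- semisimple U_n^β(F)-double orbits whose twisted norm is a norm
    (R : Matrix (Fin n) (Fin n) E → Set (Matrix (Fin n) (Fin n) E))
    (hR1 : ∀ β ∈ B, ∀ ζ ∈ R β, IsUnit ζ ∧
      ζ * nuMat σ β ζ = nuMat σ β ζ * ζ ∧
      IsRegSemisimple (nuMat σ β ζ) ∧
      ∃ γ₀ : Matrix (Fin n) (Fin n) E, IsUnit γ₀ ∧ nuMat σ β ζ = (γ₀.map ⇑σ) * γ₀)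
    (hR2 : ∀ β ∈ B, ∀ ζ' : Matrix (Fin n) (Fin n) E, IsUnit ζ' →
      IsRegSemisimple (nuMat σ β ζ') →
      (∃ γ₀ : Matrix (Fin n) (Fin n) E, IsUnit γ₀ ∧ nuMat σ β ζ' = (γ₀.map ⇑σ) * γ₀) →
      ∃! ζ, ζ ∈ R β ∧ ∃ g, InUnitary σ β g ∧ ∃ h, InUnitary σ β h ∧ g⁻¹ * ζ' * h = ζ) :
    -- the matching relation descends to a bijection [X_rss] ≃ ⨿_{β ∈ B} [Y^β_rss]
    -- totality
    (∀ t, XrssElt σ S t → ∃ q, YrssElt σ B R q ∧ MatchXY σ t q) ∧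
    -- co-totality
    (∀ q, YrssElt σ B R q → ∃ t, XrssElt σ S t ∧ MatchXY σ t q) ∧
    -- invariance of matching under the equivalence on X
    (∀ t t', XrssElt σ S t → XrssElt σ S t' → XEquiv σ t t' →
      ∀ q, YrssElt σ B R q → MatchXY σ t q → MatchXY σ t' q) ∧
    -- invariance of matching under the equivalence on Y
    (∀ q q', YrssElt σ B R q → YrssElt σ B R q' → YEquiv σ q q' →
      ∀ t, XrssElt σ S t → MatchXY σ t q → MatchXY σ t q') ∧
    -- injectivity on classes, X side
    (∀ t t', XrssElt σ S t → XrssElt σ S t' → ∀ q, YrssElt σ B R q →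
      MatchXY σ t q → MatchXY σ t' q → XEquiv σ t t') ∧
    -- injectivity on classes, Y side
    (∀ t, XrssElt σ S t → ∀ q q', YrssElt σ B R q → YrssElt σ B R q' →
      MatchXY σ t q → MatchXY σ t q' → YEquiv σ q q') := by
  refine ⟨?_, ?_, ?_, ?_, ?_, ?_⟩
  · exact fun t ht => total σ hfix hσ2 hn S hS1 B hB1 hB2 R hR2 t ht
  · exact fun q hq => cototal σ hfix hσ2 hdeg S hS1 hS2 B hB1 R hR1 q hq
  · intro t t' ht ht' hE q hq hM
    rw [match_iff] at hM ⊢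
    obtain ⟨k, hk⟩ := hM
    obtain ⟨h1, g, ug, h2, h3, h4⟩ := hE
    have hN := fixed_of_range σ hfix (hS1 _ ht.1).2.1
    have hc := T_comm σ hσ2 hN ug h2
    have : TC g ((t.1.map ⇑σ) * t.1) t.2.1 t.2.2 ((t'.1.map ⇑σ) * t'.1) t'.2.1 t'.2.2 :=
      ⟨ug, by rw [← h1]; exact hc, h3, (inv_mulVec_eq ug).1 h4⟩
    exact ⟨_, this.symm.trans hk⟩
  · intro q q' hq hq' hE t ht hM
    rw [match_iff] at hM ⊢
    obtain ⟨k, hk⟩ := hM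
    obtain ⟨β, ζ, z⟩ := q
    obtain ⟨β', ζ', z'⟩ := q'
    obtain ⟨h1, h2, u, hu, hc, h3⟩ := hE
    dsimp only at *
    subst h1 h2 h3
    have uβ := (hB1 _ hq.1).1
    exact ⟨_, hk.trans ⟨hu.1, U_comm σ uβ hu hc ((nu_eq σ uβ).1 rfl), rfl,
      s_vec_unit σ uβ z hu⟩⟩
  · intro t t' ht ht' q hq hM hM'
    rw [match_iff] at hM hM'
    obtain ⟨k, hk⟩ := hM
    obtain ⟨k', hk'⟩ := hM'
    exact inj_X σ hfix hσ2 hdeg S hS1 hS2 t t' ht ht' _ (hk.trans hk'.symm)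
  · intro t ht q q' hq hq' hM hM'
    rw [match_iff] at hM hM'
    obtain ⟨k, hk⟩ := hM
    obtain ⟨k', hk'⟩ := hM'
    exact inj_Y σ hσ2 B hB1 hB2 R hR1 hR2 q q' hq hq' _ (hk.symm.trans hk')
end
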